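/- For every type-B composition α = (α₁,…,α_r) of n, the number of join-irreducible elements of the lattice Tam_B(α) equals n² − Σ_{i=1}^r α_i(α_i−1)/2 − (α₁+1)α₁/2 if α is join, and equals n² − Σ_{i=1}^r α_i(α_i−1)/2 if α is split. -/

import Mathlib

namespace TypeB

/-- A sign-symmetric permutation of degree `n`: a bijection of `ℤ` with
`π(-i) = -π(i)` which fixes every integer of absolute value `> n`.
It restricts to a sign-symmetric permutation of `±[n]`. -/
structure SignedPerm (n : ℕ) where
  perm : Equiv.Perm ℤ
  sign_symm : ∀ i : ℤ, perm (-i) = - perm i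
  outside : ∀ i : ℤ, (n : ℤ) < |i| → perm i = i

/-- Symbols for type-B inversions: `neg i` is `[i]`, `pair i j` (with `i < j`)
is `(i,j)`, and `mixed i j` (with `i < j`) is `(−j, i)`. -/
inductive BInv (n : ℕ) : Type where
  | neg : ℕ → BInv n
  | pair : ℕ → ℕ → BInv n
  | mixed : ℕ → ℕ → BInv n
deriving DecidableEq

/-- `i⁺`: `i+1` if `i ≠ -1`, and `1` for `i = -1`. -/
def iplus (i : ℤ) : ℤ := if i = -1 then 1 else i + 1

/-- The inversion set of a sign-symmetric permutation. -/
def Inv {n : ℕ} (π : SignedPerm n) : Set (BInv n) := fun t =>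
  match t with
  | .neg i => 1 ≤ i ∧ i ≤ n ∧ π.perm (i : ℤ) < 0
  | .pair i j => 1 ≤ i ∧ i < j ∧ j ≤ n ∧ π.perm (j : ℤ) < π.perm (i : ℤ)
  | .mixed i j => 1 ≤ i ∧ i < j ∧ j ≤ n ∧ π.perm (i : ℤ) + π.perm (j : ℤ) < 0

/-- The cover-inversion set of a sign-symmetric permutation. -/
def Cov {n : ℕ} (π : SignedPerm n) : Set (BInv n) := fun t =>
  match t with
  | .neg i => 1 ≤ i ∧ i ≤ n ∧ π.perm (i : ℤ) = -1
  | .pair i j => 1 ≤ i ∧ i < j ∧ j ≤ n ∧ π.perm (i : ℤ) = iplus (π.perm (j : ℤ))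
  | .mixed i j => 1 ≤ i ∧ i < j ∧ j ≤ n ∧ π.perm (-(j : ℤ)) = iplus (π.perm (i : ℤ))

/-- The symbol `(−j, i)` in canonical form (it equals `(−i, j)`). -/
def mixedInv {n : ℕ} (i j : ℕ) : BInv n := .mixed (min i j) (max i j)

/-- A type-B composition of `n`: positive parts summing to `n`,
together with a split/join label. -/
structure BComp (n : ℕ) where
  parts : List ℕ
  pos : ∀ a ∈ parts, 0 < a
  sum_eq : parts.sum = n
  isJoin : Bool

/-- The partial sum `p_i = α₁ + ⋯ + α_i`. -/
def pSum {n : ℕ} (α : BComp n) (i : ℕ) : ℕ := (α.parts.take i).sum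

/-- The α-region of `a ∈ [n]`: the unique `i` with `p_{i-1} < a ≤ p_i`. -/
def region {n : ℕ} (α : BComp n) (a : ℕ) : ℕ :=
  ((Finset.range α.parts.length).filter (fun j => pSum α j < a)).card

/-- The first part `α₁` of a type-B composition. -/
def alpha1 {n : ℕ} (α : BComp n) : ℕ := α.parts.headI

/-- Index of the block of `Part(α)` containing `x ∈ ±[n]`; two elements lie in
a common block of `Part(α)` iff their indices agree. -/
def blockIdx {n : ℕ} (α : BComp n) (x : ℤ) : ℤ :=
  if 0 < x then
    (if α.isJoin = true ∧ region α x.toNat = 1 then 0 else (region α x.toNat : ℤ))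
  else
    (if α.isJoin = true ∧ region α (-x).toNat = 1 then 0 else -(region α (-x).toNat : ℤ))

/-- Membership in `±[n]`. -/
def inPM (n : ℕ) (x : ℤ) : Prop := x ≠ 0 ∧ -(n : ℤ) ≤ x ∧ x ≤ (n : ℤ)

/-- `π ∈ H_α`: `π` is increasing on every block of `Part(α)`. -/
def memH {n : ℕ} (α : BComp n) (π : SignedPerm n) : Prop :=
  ∀ a b : ℤ, inPM n a → inPM n b → a < b → blockIdx α a = blockIdx α b →
    π.perm a < π.perm b

/-- Common part of the type-B `(α,231)`- and `(α,312)`-patterns: indices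
`i < j < k` in `±[n]`, in pairwise distinct blocks of `Part(α)`, with `j > 0`
and `π(i) = π(k)⁺`. -/
def patternCore {n : ℕ} (α : BComp n) (π : SignedPerm n) (i j k : ℤ) : Prop :=
  inPM n i ∧ inPM n j ∧ inPM n k ∧ i < j ∧ j < k ∧ 0 < j ∧
  blockIdx α i ≠ blockIdx α j ∧ blockIdx α j ≠ blockIdx α k ∧
  blockIdx α i ≠ blockIdx α k ∧ π.perm i = iplus (π.perm k)

/-- `π` has a type-B `(α,231)`-split (resp. -join) pattern, according to the
label of `α`. -/
def has231 {n : ℕ} (α : BComp n) (π : SignedPerm n) : Prop :=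
  ∃ i j k : ℤ, patternCore α π i j k ∧
    (if α.isJoin = true then
       (((alpha1 α : ℤ) < j → π.perm i < π.perm j) ∧
        (j ≤ (alpha1 α : ℤ) → π.perm j < π.perm k))
     else π.perm i < π.perm j)

/-- `π` has a type-B `(α,312)`-split (resp. -join) pattern, according to the
label of `α`. -/
def has312 {n : ℕ} (α : BComp n) (π : SignedPerm n) : Prop :=
  ∃ i j k : ℤ, patternCore α π i j k ∧
    (if α.isJoin = true then
       (((alpha1 α : ℤ) < j → π.perm j < π.perm k) ∧
        (j ≤ (alpha1 α : ℤ) → π.perm i < π.perm j))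
     else π.perm j < π.perm k)

/-- `π ∈ H_α(231)`. -/
def mem231 {n : ℕ} (α : BComp n) (π : SignedPerm n) : Prop := memH α π ∧ ¬ has231 α π

/-- `π ∈ H_α(312)`. -/
def mem312 {n : ℕ} (α : BComp n) (π : SignedPerm n) : Prop := memH α π ∧ ¬ has312 α π

/-- The set `H_α`. -/
def Hset {n : ℕ} (α : BComp n) : Set (SignedPerm n) := {π | memH α π}

/-- The carrier of `Tam_B(α)`, namely `H_α(231)`. -/
def Tset {n : ℕ} (α : BComp n) : Set (SignedPerm n) := {π | mem231 α π}

/-- The weak order: inclusion of inversion sets. -/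
def wle {n : ℕ} (π σ : SignedPerm n) : Prop := Inv π ⊆ Inv σ

/-- `m` is the greatest lower bound of `x` and `y` within `P`, w.r.t. the weak order. -/
def isMeetIn {n : ℕ} (P : Set (SignedPerm n)) (x y m : SignedPerm n) : Prop :=
  m ∈ P ∧ wle m x ∧ wle m y ∧ ∀ z ∈ P, wle z x → wle z y → wle z m

/-- `u` is the least upper bound of `x` and `y` within `P`, w.r.t. the weak order. -/
def isJoinIn {n : ℕ} (P : Set (SignedPerm n)) (x y u : SignedPerm n) : Prop :=
  u ∈ P ∧ wle x u ∧ wle y u ∧ ∀ z ∈ P, wle x z → wle y z → wle u z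

/-- `d = Π↓(π)`: `d` is the greatest element of `{σ ∈ H_α(231) : Inv σ ⊆ Inv π}`. -/
def isProjDown {n : ℕ} (α : BComp n) (π d : SignedPerm n) : Prop :=
  mem231 α d ∧ wle d π ∧ ∀ σ, mem231 α σ → wle σ π → wle σ d

/-- `d = Π†(π)`: `d` is the greatest element of `{σ ∈ H_α(312) : Inv σ ⊆ Inv π}`. -/
def isProjDagger {n : ℕ} (α : BComp n) (π d : SignedPerm n) : Prop :=
  mem312 α d ∧ wle d π ∧ ∀ σ, mem312 α σ → wle σ π → wle σ d

/-- The value `ω_{o;α}(a)` for `a ∈ [n]`. -/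
def omegaPos {n : ℕ} (α : BComp n) (a : ℕ) : ℤ :=
  if α.isJoin = true ∧ region α a = 1 then (a : ℤ)
  else -(((pSum α (region α a) : ℤ) + (pSum α (region α a - 1) : ℤ) + 1) - (a : ℤ))

/-- The longest element `ω_{o;α}` of `H_α`, as a function on `ℤ`. -/
def omegaFun {n : ℕ} (α : BComp n) (x : ℤ) : ℤ :=
  if 0 < x ∧ x ≤ (n : ℤ) then omegaPos α x.toNat
  else if 0 < -x ∧ -x ≤ (n : ℤ) then -(omegaPos α (-x).toNat)
  else x

/-- The set of `m` such that there is a strict chain `x₀ < x₁ < ⋯ < x_m` in `P`. -/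
def chainLengths {n : ℕ} (P : Set (SignedPerm n)) : Set ℕ :=
  {m | ∃ f : Fin (m + 1) → SignedPerm n, (∀ i, f i ∈ P) ∧
        ∀ i j : Fin (m + 1), i < j → Inv (f i) ⊂ Inv (f j)}

/-- `x` is join-irreducible in `Tam_B(α)`. -/
def joinIrred {n : ℕ} (α : BComp n) (x : SignedPerm n) : Prop :=
  x ∈ Tset α ∧ ¬ (∀ y ∈ Tset α, wle x y) ∧
  ∀ y z, y ∈ Tset α → z ∈ Tset α → isJoinIn (Tset α) y z x → x = y ∨ x = z

/-- `x` is meet-irreducible in `Tam_B(α)`. -/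
def meetIrred {n : ℕ} (α : BComp n) (x : SignedPerm n) : Prop :=
  x ∈ Tset α ∧ ¬ (∀ y ∈ Tset α, wle y x) ∧
  ∀ y z, y ∈ Tset α → z ∈ Tset α → isMeetIn (Tset α) y z x → x = y ∨ x = z

/-- `x` is left modular in the lattice on `P`: `(r ∨ x) ∧ q = r ∨ (x ∧ q)`
for all `r ≤ q` in `P`. -/
def leftModular {n : ℕ} (P : Set (SignedPerm n)) (x : SignedPerm n) : Prop :=
  ∀ r q, r ∈ P → q ∈ P → wle r q →
    ∀ u v w1 w2, isJoinIn P r x u → isMeetIn P u q v →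
      isMeetIn P x q w1 → isJoinIn P r w1 w2 → v = w2

/-- The simple generator `s_i` as a function on `ℤ`: `s₀` exchanges `1` and `-1`,
and for `i ≥ 1`, `s_i` exchanges `i` with `i+1` and `-i` with `-(i+1)`. -/
def sfun (i : ℕ) (x : ℤ) : ℤ :=
  if i = 0 then (if x = 1 then -1 else if x = -1 then 1 else x)
  else if x = (i : ℤ) then (i : ℤ) + 1
  else if x = (i : ℤ) + 1 then (i : ℤ)
  else if x = -(i : ℤ) then -(i : ℤ) - 1
  else if x = -(i : ℤ) - 1 then -(i : ℤ)
  else x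

/-- `i` is one of the partial sums `p₁, …, p_{r−1}` of `α`. -/
def isPSum {n : ℕ} (α : BComp n) (i : ℕ) : Prop :=
  ∃ j : ℕ, 1 ≤ j ∧ j < α.parts.length ∧ pSum α j = i

/-- `n² − Σᵢ α_i(α_i−1)/2`, minus additionally `(α₁+1)α₁/2` when `α` is join. -/
def lengthFormula {n : ℕ} (α : BComp n) : ℕ :=
  n ^ 2 - (α.parts.map (fun a => a * (a - 1) / 2)).sum -
    (if α.isJoin = true then (alpha1 α + 1) * alpha1 α / 2 else 0)

/-! ### Signed permutations as orders on `±[n]` -/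

lemma SignedPerm.map_zero {n : ℕ} (π : SignedPerm n) : π.perm 0 = 0 := by
  have h := π.sign_symm 0
  rw [neg_zero] at h
  omega

lemma SignedPerm.ext_perm {n : ℕ} {π σ : SignedPerm n} (h : ∀ a, π.perm a = σ.perm a) : π = σ := by
  cases π
  cases σ
  congr
  exact Equiv.ext h

lemma inPM.neg {n : ℕ} {a : ℤ} (h : inPM n a) : inPM n (-a) := by
  unfold inPM at *
  omega

lemma inPM_map {n : ℕ} (π : SignedPerm n) {a : ℤ} (h : inPM n a) : inPM n (π.perm a) := by
  have h0 : π.perm a ≠ 0 := fun h0 => h.1 (π.perm.injective (h0.trans π.map_zero.symm))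
  have h1 : ¬ (n : ℤ) < |π.perm a| := fun hlt => by
    have h2 := π.perm.injective (π.outside _ hlt)
    rw [h2] at hlt
    have h3 := abs_le.2 ⟨h.2.1, h.2.2⟩
    omega
  have := abs_le.1 (not_lt.1 h1)
  exact ⟨h0, this.1, this.2⟩

lemma exists_inPM_preimage {n : ℕ} (π : SignedPerm n) {v : ℤ} (h : inPM n v) :
    ∃ a, inPM n a ∧ π.perm a = v := by
  refine ⟨π.perm.symm v, ?_, by simp⟩
  by_contra hc
  have hv : π.perm (π.perm.symm v) = v := by simp
  rcases eq_or_ne (π.perm.symm v) 0 with h0 | h0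
  · rw [h0, π.map_zero] at hv
    exact h.1 hv.symm
  · have hlt : (n : ℤ) < |π.perm.symm v| := by
      by_contra hle
      have := abs_le.1 (not_lt.1 hle)
      exact hc ⟨h0, this.1, this.2⟩
    have h1 := π.outside _ hlt
    rw [hv] at h1
    rw [← h1] at hc
    exact hc h

/-- `π(b)` and `π(a)` are consecutive values of `±[n]`, in this order. -/
def IsCover {n : ℕ} (π : SignedPerm n) (a b : ℤ) : Prop :=
  π.perm b < π.perm a ∧ ∀ m, inPM n m → ¬ (π.perm b < π.perm m ∧ π.perm m < π.perm a)

lemma eq_iplus_iff {n : ℕ} (π : SignedPerm n) {a b : ℤ} (ha : inPM n a) (hb : inPM n b) :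
    π.perm a = iplus (π.perm b) ↔ IsCover π a b := by
  have ha' := inPM_map π ha
  have hb' := inPM_map π hb
  unfold IsCover iplus
  constructor
  · intro h
    refine ⟨by split_ifs at h <;> omega, fun m hm hlt => ?_⟩
    have hm' := (inPM_map π hm).1
    split_ifs at h <;> omega
  · rintro ⟨h1, h2⟩
    by_contra hne
    obtain ⟨m, hm, hmv⟩ := exists_inPM_preimage π
      (v := if π.perm b = -1 then 1 else π.perm b + 1) (by
        unfold inPM at *
        split_ifs at * <;> omega)
    refine h2 m hm ?_
    have := ha'.1
    rw [hmv]
    split_ifs at * <;> omega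

lemma IsCover.neg {n : ℕ} {π : SignedPerm n} {a b : ℤ} (h : IsCover π a b) :
    IsCover π (-b) (-a) := by
  refine ⟨?_, fun m hm hlt => h.2 (-m) hm.neg ?_⟩
  · have := h.1
    rw [π.sign_symm, π.sign_symm]
    omega
  · rw [π.sign_symm, π.sign_symm] at hlt
    rw [π.sign_symm]
    omega

lemma wle_iff_canonical {n : ℕ} {π σ : SignedPerm n} :
    wle π σ ↔ ∀ a b, inPM n a → inPM n b → -b ≤ a → a < b →
      π.perm b < π.perm a → σ.perm b < σ.perm a := by
  constructor
  · intro h a b ha hb hba hab hlt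
    have hb0 : 0 < b := by omega
    have hbn := hb.2.2
    lift b to ℕ using hb0.le
    rcases lt_or_gt_of_ne ha.1 with ha0 | ha0
    · obtain ⟨a', rfl⟩ : ∃ a' : ℕ, a = -(a' : ℤ) := ⟨(-a).toNat, by omega⟩
      rw [π.sign_symm] at hlt
      rw [σ.sign_symm]
      rcases eq_or_ne a' b with rfl | hne
      · have := @h (.neg a') ⟨by omega, by omega, by omega⟩
        have := this.2.2
        omega
      · have := @h (.mixed a' b) ⟨by omega, by omega, by omega, by omega⟩
        have := this.2.2.2
        omega
    · lift a to ℕ using ha0.le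
      exact (@h (.pair a b) ⟨by omega, by omega, by omega, hlt⟩).2.2.2
  · intro h t ht
    match t, ht with
    | .neg i, ht =>
      obtain ⟨h1, h2, h3⟩ := ht
      have hi : inPM n i := ⟨by omega, by omega, by omega⟩
      have := h (-i) i hi.neg hi le_rfl (by omega) (by rw [π.sign_symm]; omega)
      rw [σ.sign_symm] at this
      exact ⟨h1, h2, by omega⟩
    | .pair i j, ht =>
      obtain ⟨h1, h2, h3, h4⟩ := ht
      exact ⟨h1, h2, h3, h i j ⟨by omega, by omega, by omega⟩ ⟨by omega, by omega, by omega⟩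
        (by omega) (by omega) h4⟩
    | .mixed i j, ht =>
      obtain ⟨h1, h2, h3, h4⟩ := ht
      have hi : inPM n i := ⟨by omega, by omega, by omega⟩
      have := h (-i) j hi.neg ⟨by omega, by omega, by omega⟩ (by omega) (by omega)
        (by rw [π.sign_symm]; omega)
      rw [σ.sign_symm] at this
      exact ⟨h1, h2, h3, by omega⟩

lemma wle_iff {n : ℕ} {π σ : SignedPerm n} :
    wle π σ ↔ ∀ a b, inPM n a → inPM n b → a < b →
      π.perm b < π.perm a → σ.perm b < σ.perm a := by
  rw [wle_iff_canonical]
  refine ⟨fun h a b ha hb hab hlt => ?_, fun h a b ha hb _ => h a b ha hb⟩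
  by_cases hba : -b ≤ a
  · exact h a b ha hb hba hab hlt
  · have := h (-b) (-a) hb.neg ha.neg (by omega) (by omega)
      (by rw [π.sign_symm, π.sign_symm]; omega)
    rw [σ.sign_symm, σ.sign_symm] at this
    omega

lemma wle_rfl {n : ℕ} {π : SignedPerm n} : wle π π := fun _ h => h

lemma wle.trans {n : ℕ} {π σ τ : SignedPerm n} (h : wle π σ) (h' : wle σ τ) : wle π τ :=
  fun _ ht => h' (h ht)

lemma perm_ne {n : ℕ} (π : SignedPerm n) {a b : ℤ} (h : a ≠ b) : π.perm a ≠ π.perm b :=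
  fun h' => h (π.perm.injective h')

lemma wle.antisymm {n : ℕ} {π σ : SignedPerm n} (h : wle π σ) (h' : wle σ π) : π = σ := by
  rw [wle_iff] at h h'
  have key : ∀ a b, inPM n a → inPM n b → π.perm a < π.perm b → σ.perm a < σ.perm b := by
    intro a b ha hb hlt
    rcases lt_trichotomy a b with hab | hab | hab
    · by_contra hc
      have := h' a b ha hb hab (lt_of_le_of_ne (not_lt.1 hc) (perm_ne σ hab.ne').symm.symm)
      omega
    · subst hab
      omega
    · exact h b a hb ha hab hlt
  have hpos : ∀ a, inPM n a → 0 < π.perm a → 0 < σ.perm a := by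
    intro a ha h0
    have := key (-a) a ha.neg ha (by rw [π.sign_symm]; omega)
    rw [σ.sign_symm] at this
    omega
  have hneg : ∀ a, inPM n a → π.perm a < 0 → σ.perm a < 0 := by
    intro a ha h0
    have := hpos (-a) ha.neg (by rw [π.sign_symm]; omega)
    rw [σ.sign_symm] at this
    omega
  have hout : ∀ a, ¬ inPM n a → π.perm a = a ∧ σ.perm a = a := by
    intro a ha
    rcases eq_or_ne a 0 with rfl | h0
    · exact ⟨π.map_zero, σ.map_zero⟩
    · have : (n : ℤ) < |a| := by
        by_contra hle
        have := abs_le.1 (not_lt.1 hle)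
        exact ha ⟨h0, this.1, this.2⟩
      exact ⟨π.outside a this, σ.outside a this⟩
  have keyZ : ∀ a b, π.perm a < π.perm b → σ.perm a < σ.perm b := by
    intro a b hlt
    by_cases ha : inPM n a <;> by_cases hb : inPM n b
    · exact key a b ha hb hlt
    · have h1 := hout b hb
      have h2 := hpos a ha
      have h3 := hneg a ha
      have h4 := inPM_map π ha
      have h5 := inPM_map σ ha
      unfold inPM at *
      omega
    · have h1 := hout a ha
      have h2 := hpos b hb
      have h3 := hneg b hb
      have h4 := inPM_map π hb
      have h5 := inPM_map σ hb
      unfold inPM at *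
      omega
    · rw [(hout a ha).1, (hout b hb).1] at hlt
      rwa [(hout a ha).2, (hout b hb).2]
  have hmono : StrictMono (π.perm.symm.trans σ.perm) := by
    intro u v huv
    simpa using keyZ (π.perm.symm u) (π.perm.symm v) (by simpa using huv)
  let e : ℤ ≃o ℤ := hmono.orderIsoOfSurjective _ (π.perm.symm.trans σ.perm).surjective
  have he : ∀ u, e u = σ.perm (π.perm.symm u) := fun u => rfl
  have he0 : e 0 = 0 := by
    have : π.perm.symm 0 = 0 := by rw [Equiv.symm_apply_eq, π.map_zero]
    rw [he, this, σ.map_zero]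
  have hsucc : ∀ u, e (u + 1) = e u + 1 := fun u => by
    simpa [Order.succ_eq_add_one] using e.map_succ u
  have hid : ∀ u, e u = u := by
    intro u
    induction u using Int.induction_on with
    | zero => exact he0
    | succ i ih => rw [hsucc, ih]
    | pred i ih =>
      have := hsucc (-(i : ℤ) - 1)
      rw [sub_add_cancel, ih] at this
      omega
  refine SignedPerm.ext_perm fun a => ?_
  have := hid (π.perm a)
  rw [he] at this
  simpa using this.symm

/-- The elements of `±[n]`. -/
noncomputable def pmFinset (n : ℕ) : Finset ℤ := (Finset.Icc (-(n : ℤ)) n).filter (· ≠ 0)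

lemma mem_pmFinset {n : ℕ} {a : ℤ} : a ∈ pmFinset n ↔ inPM n a := by
  simp only [pmFinset, Finset.mem_filter, Finset.mem_Icc, inPM]
  tauto

/-- Every odd injective key function on `±[n]` is order-equivalent to a sign-symmetric
permutation. -/
lemma exists_signedPerm_of_key {n : ℕ} (f : ℤ → ℤ) (hodd : ∀ a, inPM n a → f (-a) = - f a)
    (hinj : ∀ a b, inPM n a → inPM n b → f a = f b → a = b) :
    ∃ π : SignedPerm n, ∀ a b, inPM n a → inPM n b → (π.perm a < π.perm b ↔ f a < f b) := by
  classical
  have hne : ∀ a, inPM n a → f a ≠ 0 := by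
    intro a ha h0
    have h1 := hodd a ha
    have h2 := hinj a (-a) ha ha.neg (by omega)
    exact ha.1 (by omega)
  let ρ : ℤ → ℕ := fun a => ((Finset.Icc (1 : ℤ) n).filter (fun b => |f b| ≤ |f a|)).card
  have hfabs : ∀ a, inPM n a → |f (|a|)| = |f a| := by
    intro a ha
    rcases abs_choice a with h | h <;> rw [h]
    rw [hodd a ha, abs_neg]
  have hρlt : ∀ a b, inPM n a → inPM n b → |f a| < |f b| → ρ a < ρ b := by
    intro a b ha hb hab
    refine Finset.card_lt_card (Finset.ssubset_iff_of_subset ?_ |>.2 ?_)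
    · intro c
      simp only [Finset.mem_filter]
      rintro ⟨h1, h2⟩
      exact ⟨h1, by omega⟩
    · refine ⟨|b|, ?_, ?_⟩
      · have := abs_pos.2 hb.1
        have h3 := abs_le.2 ⟨hb.2.1, hb.2.2⟩
        have := hfabs b hb
        simp only [Finset.mem_filter, Finset.mem_Icc, this]
        omega
      · have := hfabs b hb
        simp only [Finset.mem_filter, this]
        omega
  have hρpos : ∀ a, inPM n a → 0 < ρ a := by
    intro a ha
    refine Finset.card_pos.2 ⟨|a|, ?_⟩
    have := abs_pos.2 ha.1
    have h3 := abs_le.2 ⟨ha.2.1, ha.2.2⟩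
    have := hfabs a ha
    simp only [Finset.mem_filter, Finset.mem_Icc, this]
    omega
  have hρle : ∀ a, ρ a ≤ n := by
    intro a
    refine (Finset.card_filter_le _ _).trans ?_
    simp
  have hρneg : ∀ a, inPM n a → ρ (-a) = ρ a := by
    intro a ha
    simp only [ρ, hodd a ha, abs_neg]
  let g : ℤ → ℤ := fun a => if inPM n a then (if 0 < f a then (ρ a : ℤ) else -ρ a) else a
  have hg1 : ∀ a, inPM n a → 0 < f a → g a = ρ a := fun a ha h => by simp [g, ha, h]
  have hg2 : ∀ a, inPM n a → f a < 0 → g a = -ρ a := fun a ha h => by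
    simp [g, ha, not_lt.2 h.le]
  have hg3 : ∀ a, ¬ inPM n a → g a = a := fun a ha => by simp [g, ha]
  have hlt : ∀ a b, inPM n a → inPM n b → f a < f b → g a < g b := by
    intro a b ha hb hab
    have h1 := hρpos a ha
    have h2 := hρpos b hb
    rcases lt_or_gt_of_ne (hne a ha) with h | h <;> rcases lt_or_gt_of_ne (hne b hb) with h' | h'
    · rw [hg2 a ha h, hg2 b hb h']
      have := hρlt b a hb ha (by rw [abs_of_neg h, abs_of_neg h']; omega)
      omega
    · rw [hg2 a ha h, hg1 b hb h']
      omega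
    · omega
    · rw [hg1 a ha h, hg1 b hb h']
      have := hρlt a b ha hb (by rw [abs_of_pos h, abs_of_pos h']; omega)
      omega
  have hgPM : ∀ a, inPM n a → inPM n (g a) := by
    intro a ha
    have h1 := hρpos a ha
    have h2 := hρle a
    rcases lt_or_gt_of_ne (hne a ha) with h | h
    · rw [hg2 a ha h]
      exact ⟨by omega, by omega, by omega⟩
    · rw [hg1 a ha h]
      exact ⟨by omega, by omega, by omega⟩
  have hgiff : ∀ a b, inPM n a → inPM n b → (g a < g b ↔ f a < f b) := by
    intro a b ha hb
    refine ⟨fun h => ?_, hlt a b ha hb⟩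
    by_contra hc
    rcases eq_or_lt_of_le (not_lt.1 hc) with he | he
    · rw [hinj b a hb ha he] at h
      omega
    · have := hlt b a hb ha he
      omega
  have hginj : Function.Injective g := by
    intro a b hab
    by_cases ha : inPM n a <;> by_cases hb : inPM n b
    · refine hinj a b ha hb ?_
      by_contra hne'
      rcases lt_or_gt_of_ne hne' with h | h
      · have := hlt a b ha hb h
        omega
      · have := hlt b a hb ha h
        omega
    · have := hgPM a ha
      rw [hab, hg3 b hb] at this
      exact absurd this hb
    · have := hgPM b hb
      rw [← hab, hg3 a ha] at this
      exact absurd this ha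
    · rwa [hg3 a ha, hg3 b hb] at hab
  have hgsurj : Function.Surjective g := by
    intro y
    by_cases hy : inPM n y
    · have hmaps : Set.MapsTo g (pmFinset n : Set ℤ) (pmFinset n : Set ℤ) := by
        intro a ha
        exact mem_pmFinset.2 (hgPM a (mem_pmFinset.1 ha))
      obtain ⟨a, -, ha⟩ := Finset.surjOn_of_injOn_of_card_le g hmaps hginj.injOn le_rfl
        (mem_pmFinset.2 hy)
      exact ⟨a, ha⟩
    · exact ⟨y, hg3 y hy⟩
  have hgodd : ∀ a, g (-a) = - g a := by
    intro a
    by_cases ha : inPM n a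
    · have h1 := hodd a ha
      rcases lt_or_gt_of_ne (hne a ha) with h | h
      · rw [hg2 a ha h, hg1 (-a) ha.neg (by omega), hρneg a ha]
        omega
      · rw [hg1 a ha h, hg2 (-a) ha.neg (by omega), hρneg a ha]
    · rw [hg3 a ha, hg3 (-a) (fun h => ha (by simpa using h.neg))]
  refine ⟨⟨Equiv.ofBijective g ⟨hginj, hgsurj⟩, hgodd, fun i hi => hg3 i fun h => ?_⟩, hgiff⟩
  have := abs_le.2 ⟨h.2.1, h.2.2⟩
  omega

/-! ### Blocks -/

lemma region_mono {n : ℕ} (α : BComp n) {a b : ℕ} (h : a ≤ b) : region α a ≤ region α b := by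
  refine Finset.card_le_card fun j => ?_
  simp only [Finset.mem_filter]
  exact fun hj => ⟨hj.1, hj.2.trans_le h⟩

lemma BComp.exists_parts {n : ℕ} (hn : 1 ≤ n) (α : BComp n) : ∃ p L, α.parts = p :: L := by
  have := α.sum_eq
  cases h : α.parts with
  | nil =>
    rw [h, List.sum_nil] at this
    omega
  | cons p L => exact ⟨p, L, rfl⟩

lemma region_pos {n : ℕ} (hn : 1 ≤ n) (α : BComp n) {a : ℕ} (ha : 1 ≤ a) : 1 ≤ region α a := by
  obtain ⟨p, L, h⟩ := α.exists_parts hn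
  refine Finset.card_pos.2 ⟨0, ?_⟩
  simp only [Finset.mem_filter, Finset.mem_range, h, List.length_cons, pSum, List.take_zero,
    List.sum_nil]
  omega

lemma region_eq_one_iff {n : ℕ} (hn : 1 ≤ n) (α : BComp n) {a : ℕ} (ha : 1 ≤ a) (han : a ≤ n) :
    region α a = 1 ↔ a ≤ alpha1 α := by
  obtain ⟨p, L, h⟩ := α.exists_parts hn
  have hp : alpha1 α = p := by simp [alpha1, h]
  have h0 : pSum α 0 = 0 := by simp [pSum]
  have h1 : ∀ j, pSum α (j + 1) = p + (L.take j).sum := fun j => by simp [pSum, h]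
  rw [hp]
  constructor
  · intro hr
    by_contra hlt
    have hL : L ≠ [] := by
      rintro rfl
      have := α.sum_eq
      simp only [h, List.sum_cons, List.sum_nil] at this
      omega
    have hlen := List.length_pos_iff.2 hL
    have : ({0, 1} : Finset ℕ) ⊆
        (Finset.range α.parts.length).filter (fun j => pSum α j < a) := by
      intro j hj
      simp only [Finset.mem_insert, Finset.mem_singleton] at hj
      have h10 : pSum α 1 = p + (L.take 0).sum := h1 0
      simp only [Finset.mem_filter, Finset.mem_range, h, List.length_cons]
      rw [List.take_zero, List.sum_nil] at h10
      rcases hj with rfl | rfl <;> constructor <;> omega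
    have := Finset.card_le_card this
    rw [Finset.card_pair (by omega)] at this
    unfold region at hr
    omega
  · intro hle
    have : (Finset.range α.parts.length).filter (fun j => pSum α j < a) = {0} := by
      ext j
      simp only [Finset.mem_filter, Finset.mem_range, Finset.mem_singleton, h, List.length_cons]
      cases j with
      | zero => omega
      | succ j =>
        rw [h1]
        omega
    unfold region
    rw [this, Finset.card_singleton]

lemma blockIdx_of_pos {n : ℕ} (α : BComp n) {x : ℤ} (hx : 0 < x) :
    blockIdx α x =
      if α.isJoin = true ∧ region α x.toNat = 1 then 0 else (region α x.toNat : ℤ) := by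
  simp [blockIdx, hx]

lemma blockIdx_neg {n : ℕ} (α : BComp n) {x : ℤ} (hx : x ≠ 0) :
    blockIdx α (-x) = - blockIdx α x := by
  rcases lt_or_gt_of_ne hx with h | h
  · rw [blockIdx_of_pos α (show 0 < -x by omega), blockIdx, if_neg (show ¬ 0 < x by omega)]
    split_ifs <;> simp
  · rw [blockIdx_of_pos α h, blockIdx, if_neg (by omega), neg_neg]
    split_ifs <;> simp

lemma blockIdx_nonneg {n : ℕ} (α : BComp n) {x : ℤ} (hx : 0 < x) : 0 ≤ blockIdx α x := by
  rw [blockIdx_of_pos α hx]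
  split_ifs <;> omega

lemma blockIdx_mono {n : ℕ} (hn : 1 ≤ n) (α : BComp n) {x y : ℤ} (hx : x ≠ 0) (hy : y ≠ 0)
    (hxy : x ≤ y) : blockIdx α x ≤ blockIdx α y := by
  have hpos : ∀ x y : ℤ, 0 < x → x ≤ y → blockIdx α x ≤ blockIdx α y := by
    intro x y hx hxy
    rw [blockIdx_of_pos α hx, blockIdx_of_pos α (hx.trans_le hxy)]
    have h1 := region_mono α (Int.toNat_le_toNat hxy)
    have h2 := region_pos hn α (show 1 ≤ x.toNat by omega)
    split_ifs with h3 h4 h4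
    · exact le_rfl
    · omega
    · exact absurd ⟨h4.1, by omega⟩ h3
    · omega
  rcases lt_or_gt_of_ne hx with h | h
  · have hx' := blockIdx_nonneg α (x := -x) (by omega)
    rw [blockIdx_neg α hx] at hx'
    rcases lt_or_gt_of_ne hy with h' | h'
    · have := hpos (-y) (-x) (by omega) (by omega)
      rw [blockIdx_neg α hx, blockIdx_neg α hy] at this
      omega
    · have := blockIdx_nonneg α h'
      omega
  · exact hpos x y h hxy

lemma blockIdx_pos_iff {n : ℕ} (hn : 1 ≤ n) (α : BComp n) {x : ℤ} (hx : 0 < x) (hxn : x ≤ n) :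
    0 < blockIdx α x ↔ (α.isJoin = true → (alpha1 α : ℤ) < x) := by
  rw [blockIdx_of_pos α hx]
  have h1 := region_pos hn α (show 1 ≤ x.toNat by omega)
  have h2 := region_eq_one_iff hn α (show 1 ≤ x.toNat by omega) (by omega)
  split_ifs with h
  · have := h2.1 h.2
    refine ⟨fun h' => absurd h' (lt_irrefl _), fun h' => ?_⟩
    have := h' h.1
    omega
  · refine ⟨fun _ h' => ?_, fun _ => by omega⟩
    by_contra hc
    exact h ⟨h', h2.2 (by omega)⟩

lemma has231_iff {n : ℕ} (hn : 1 ≤ n) (α : BComp n) (π : SignedPerm n) :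
    has231 α π ↔ ∃ i j k, inPM n i ∧ inPM n j ∧ inPM n k ∧ i < j ∧ j < k ∧ 0 < j ∧
      blockIdx α i < blockIdx α j ∧ blockIdx α j < blockIdx α k ∧ IsCover π i k ∧
      (0 < blockIdx α j → π.perm i < π.perm j) ∧
      (blockIdx α j = 0 → π.perm j < π.perm k) := by
  unfold has231
  refine exists_congr fun i => exists_congr fun j => exists_congr fun k => ?_
  unfold patternCore
  constructor
  · rintro ⟨⟨hi, hj, hk, hij, hjk, h0, h1, h2, -, h4⟩, h5⟩
    have m1 := blockIdx_mono hn α hi.1 hj.1 hij.le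
    have m2 := blockIdx_mono hn α hj.1 hk.1 hjk.le
    have hb := blockIdx_pos_iff hn α h0 hj.2.2
    have hb' := blockIdx_nonneg α h0
    refine ⟨hi, hj, hk, hij, hjk, h0, by omega, by omega, (eq_iplus_iff π hi hk).1 h4, ?_, ?_⟩
    · intro hB
      split_ifs at h5 with hJ
      · exact h5.1 (hb.1 hB hJ)
      · exact h5
    · intro hB
      split_ifs at h5 with hJ
      · refine h5.2 ?_
        by_contra hc
        have := hb.2 (fun _ => by omega)
        omega
      · have := hb.2 (fun h => absurd h hJ)
        omega
  · rintro ⟨hi, hj, hk, hij, hjk, h0, h1, h2, h4, h5, h6⟩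
    have hb := blockIdx_pos_iff hn α h0 hj.2.2
    have hb' := blockIdx_nonneg α h0
    refine ⟨⟨hi, hj, hk, hij, hjk, h0, by omega, by omega, by omega,
      (eq_iplus_iff π hi hk).2 h4⟩, ?_⟩
    split_ifs with hJ
    · refine ⟨fun h => h5 (hb.2 fun _ => h), fun h => h6 ?_⟩
      by_contra hc
      have := hb.1 (by omega) hJ
      omega
    · exact h5 (hb.2 fun h => absurd h hJ)

/-! ### Cover inversions and the projection onto `H_α(231)` -/

lemma exists_isCover_of_forall_not_between {n : ℕ} (π : SignedPerm n) {a b : ℤ} (ha : inPM n a)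
    (hb : inPM n b) (hlt : π.perm b < π.perm a)
    (hbt : ∀ m, inPM n m → a < m → m < b → ¬ (π.perm b < π.perm m ∧ π.perm m < π.perm a)) :
    ∃ m m', inPM n m ∧ inPM n m' ∧ m ≤ a ∧ b ≤ m' ∧ π.perm b ≤ π.perm m' ∧
      π.perm m ≤ π.perm a ∧ IsCover π m m' := by
  obtain ⟨m, hm, hmin⟩ := Finset.exists_min_image
    ((pmFinset n).filter (fun p => p ≤ a ∧ π.perm b < π.perm p ∧ π.perm p ≤ π.perm a)) π.perm
    ⟨a, by simp [mem_pmFinset, ha, hlt]⟩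
  simp only [Finset.mem_filter, mem_pmFinset] at hm hmin
  obtain ⟨m', hm', hmax⟩ := Finset.exists_max_image
    ((pmFinset n).filter (fun p => π.perm b ≤ π.perm p ∧ π.perm p < π.perm m)) π.perm
    ⟨b, by simp [mem_pmFinset, hb, hm.2.2.1]⟩
  simp only [Finset.mem_filter, mem_pmFinset] at hm' hmax
  refine ⟨m, m', hm.1, hm'.1, hm.2.1, ?_, hm'.2.1, hm.2.2.2, hm'.2.2, fun p hp hpp => ?_⟩
  · by_contra hc
    have hne := perm_ne π (show m' ≠ b by omega)
    have h1 := hbt m' hm'.1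
    have h2 := hmin m'
    by_cases h3 : a < m'
    · exact h1 h3 (by omega) ⟨by omega, by omega⟩
    · have := h2 ⟨hm'.1, by omega, by omega, by omega⟩
      omega
  · have := hmax p ⟨hp, by omega, by omega⟩
    omega

lemma wle_of_forall_isCover {n : ℕ} {x z : SignedPerm n}
    (h : ∀ m m', inPM n m → inPM n m' → m < m' → IsCover x m m' →
      ∀ a b, inPM n a → inPM n b → m ≤ a → a < b → b ≤ m' → x.perm b ≤ x.perm m' →
        x.perm m ≤ x.perm a → z.perm b < z.perm a) : wle x z := by
  rw [wle_iff]
  have key : ∀ N : ℕ, ∀ a b, inPM n a → inPM n b → a < b → x.perm b < x.perm a →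
      (x.perm a - x.perm b).toNat = N → z.perm b < z.perm a := by
    intro N
    induction N using Nat.strong_induction_on with
    | _ N ih =>
      intro a b ha hb hab hlt hN
      by_cases hm : ∃ m, inPM n m ∧ a < m ∧ m < b ∧ x.perm b < x.perm m ∧ x.perm m < x.perm a
      · obtain ⟨m, hm, ham, hmb, h1, h2⟩ := hm
        exact (ih _ (by omega) m b hm hb hmb h1 rfl).trans (ih _ (by omega) a m ha hm ham h2 rfl)
      · push Not at hm
        obtain ⟨m, m', h1, h2, h3, h4, h5, h6, h7⟩ :=
          exists_isCover_of_forall_not_between x ha hb hlt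
            (fun m h1 h2 h3 h4 => by have := hm m h1 h2 h3 h4.1; omega)
        exact h m m' h1 h2 (by omega) h7 a b ha hb h3 hab h4 h5 h6
  exact fun a b ha hb hab hlt => key _ a b ha hb hab hlt rfl

/-- The odd function exchanging the values `v` and `w`. -/
def swapValue (v w u : ℤ) : ℤ :=
  if u = v then w else if u = w then v else if u = -v then -w else if u = -w then -v else u

lemma swapValue_neg {v w u : ℤ} (hv : v ≠ 0) (hw : w ≠ 0) (h : v = w + 1 ∨ w = -1 ∧ v = 1) :
    swapValue v w (-u) = - swapValue v w u := by
  unfold swapValue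
  split_ifs <;> omega

lemma swapValue_inj {v w u u' : ℤ} (hv : v ≠ 0) (hw : w ≠ 0) (h : v = w + 1 ∨ w = -1 ∧ v = 1)
    (he : swapValue v w u = swapValue v w u') : u = u' := by
  unfold swapValue at he
  split_ifs at he <;> omega

lemma swapValue_lt_iff {v w u u' : ℤ} (hv : v ≠ 0) (hw : w ≠ 0) (hu : u ≠ 0) (hu' : u' ≠ 0)
    (h : v = w + 1 ∨ w = -1 ∧ v = 1) (hne : u ≠ u') (h1 : ¬ (u = w ∧ u' = v))
    (h2 : ¬ (u = -v ∧ u' = -w)) :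
    swapValue v w u' < swapValue v w u ↔
      u' < u ∧ ¬ (u = v ∧ u' = w) ∧ ¬ (u = -w ∧ u' = -v) := by
  unfold swapValue
  split_ifs <;> omega

lemma exists_swap {n : ℕ} (π : SignedPerm n) {i k : ℤ} (hi : inPM n i) (hk : inPM n k)
    (hik : i < k) (h : IsCover π i k) :
    ∃ σ : SignedPerm n, ∀ a b, inPM n a → inPM n b → a < b →
      (σ.perm b < σ.perm a ↔ π.perm b < π.perm a ∧ ¬ (a = i ∧ b = k) ∧ ¬ (a = -k ∧ b = -i)) := by
  have hval : π.perm i = π.perm k + 1 ∨ π.perm k = -1 ∧ π.perm i = 1 := by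
    have := (eq_iplus_iff π hi hk).2 h
    unfold iplus at this
    split_ifs at this <;> omega
  have h1 := (inPM_map π hi).1
  have h2 := (inPM_map π hk).1
  have hinj : ∀ a c, π.perm a = π.perm c ↔ a = c := fun a c => π.perm.injective.eq_iff
  have hneg : ∀ a c, π.perm a = -π.perm c ↔ a = -c := fun a c => by
    rw [← π.sign_symm, hinj]
  obtain ⟨σ, hσ⟩ := exists_signedPerm_of_key (n := n)
    (fun a => swapValue (π.perm i) (π.perm k) (π.perm a))
    (fun a _ => by simp only [π.sign_symm, swapValue_neg h1 h2 hval])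
    (fun a b _ _ hab => π.perm.injective (swapValue_inj h1 h2 hval hab))
  refine ⟨σ, fun a b ha hb hab => ?_⟩
  rw [hσ b a hb ha, swapValue_lt_iff h1 h2 (inPM_map π ha).1 (inPM_map π hb).1 hval
    (perm_ne π hab.ne) (by rw [hinj, hinj]; omega) (by rw [hneg, hneg]; omega),
    hinj, hinj, hneg, hneg]

lemma memH_of_wle {n : ℕ} {α : BComp n} {π σ : SignedPerm n} (hπ : memH α π) (h : wle σ π) :
    memH α σ := by
  intro a b ha hb hab hB
  by_contra hc
  have h1 := wle_iff.1 h a b ha hb hab (lt_of_le_of_ne (not_lt.1 hc) (perm_ne σ hab.ne'))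
  have := hπ a b ha hb hab hB
  omega

/-- The number of inversions of `π`, as pairs of elements of `±[n]`. -/
noncomputable def invCount {n : ℕ} (π : SignedPerm n) : ℕ :=
  ((pmFinset n ×ˢ pmFinset n).filter
    (fun p => p.1 < p.2 ∧ π.perm p.2 < π.perm p.1)).card

/-- Every `π ∈ H_α` has a largest element of `H_α(231)` below it. -/
lemma exists_isProjDown {n : ℕ} (hn : 1 ≤ n) (α : BComp n) (π : SignedPerm n) (hπ : memH α π) :
    ∃ d, isProjDown α π d := by
  induction hN : invCount π using Nat.strong_induction_on generalizing π with
  | _ N ih =>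
    by_cases hT : has231 α π
    · obtain ⟨i, j, k, hi, hj, hk, hij, hjk, h0, hB1, hB2, hc, hp, hz⟩ := (has231_iff hn α π).1 hT
      obtain ⟨σ, hσ⟩ := exists_swap π hi hk (hij.trans hjk) hc
      have hσπ : wle σ π := wle_iff.2 fun a b ha hb hab h => ((hσ a b ha hb hab).1 h).1
      have hlt : invCount σ < invCount π := by
        refine Finset.card_lt_card (Finset.ssubset_iff_of_subset ?_ |>.2 ⟨(i, k), ?_, ?_⟩)
        · intro p
          simp only [Finset.mem_filter, Finset.mem_product, mem_pmFinset]
          rintro ⟨⟨h1, h2⟩, h3, h4⟩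
          exact ⟨⟨h1, h2⟩, h3, ((hσ _ _ h1 h2 h3).1 h4).1⟩
        · simp only [Finset.mem_filter, Finset.mem_product, mem_pmFinset]
          exact ⟨⟨hi, hk⟩, by omega, hc.1⟩
        · simp only [Finset.mem_filter, Finset.mem_product, mem_pmFinset, not_and]
          intro _ _ h
          exact ((hσ i k hi hk (by omega)).1 h).2.1 ⟨rfl, rfl⟩
      obtain ⟨d, hd1, hd2, hd3⟩ := ih _ (hN ▸ hlt) σ (memH_of_wle hπ hσπ) rfl
      refine ⟨d, hd1, hd2.trans hσπ, fun y hy hyπ => hd3 y hy ?_⟩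
      have hyπ' := wle_iff.1 hyπ
      have hnot : ¬ y.perm k < y.perm i := by
        intro hki
        obtain ⟨m, m', hm, hm', h1, h2, h3, h4, h5⟩ :=
          exists_isCover_of_forall_not_between y hi hk hki (by
            rintro m hm him hmk ⟨h1, h2⟩
            exact hc.2 m hm ⟨hyπ' m k hm hk hmk h1, hyπ' i m hi hm him h2⟩)
        have hB3 := blockIdx_mono hn α hm.1 hi.1 h1
        have hB4 := blockIdx_mono hn α hk.1 hm'.1 h2
        refine hy.2 ((has231_iff hn α y).2 ⟨m, j, m', hm, hj, hm', by omega, by omega, h0,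
          by omega, by omega, h5, fun hB => ?_, fun hB => ?_⟩)
        · have h6 := hp hB
          have h7 := hyπ' i j hi hj hij
          have h8 := perm_ne y hij.ne
          omega
        · have h6 := hz hB
          have h7 := hyπ' j k hj hk hjk
          have h8 := perm_ne y hjk.ne
          omega
      refine wle_iff.2 fun a b ha hb hab h => (hσ a b ha hb hab).2 ⟨hyπ' a b ha hb hab h, ?_, ?_⟩
      · rintro ⟨rfl, rfl⟩
        exact hnot h
      · rintro ⟨rfl, rfl⟩
        rw [y.sign_symm, y.sign_symm] at h
        omega
    · exact ⟨π, ⟨hπ, hT⟩, wle_rfl, fun _ _ h => h⟩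

/-! ### The element with a prescribed cover inversion -/

/-- The odd extension of a function on the positive integers. -/
def oddExt (P : ℤ → ℤ) (a : ℤ) : ℤ := if 0 < a then P a else -P (-a)

lemma oddExt_of_pos {P : ℤ → ℤ} {a : ℤ} (h : 0 < a) : oddExt P a = P a := if_pos h

lemma oddExt_of_neg {P : ℤ → ℤ} {a : ℤ} (h : a < 0) : oddExt P a = -P (-a) := if_neg h.not_gt

lemma mul_add_lt_mul_add_iff_lex {N p q r s : ℤ} (hr : -N ≤ r) (hr' : r ≤ N) (hs : -N ≤ s)
    (hs' : s ≤ N) :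
    (2 * N + 1) * p + r < (2 * N + 1) * q + s ↔ p < q ∨ p = q ∧ r < s := by
  constructor
  · intro h
    rcases lt_trichotomy p q with hpq | rfl | hpq
    · exact Or.inl hpq
    · exact Or.inr ⟨rfl, by omega⟩
    · nlinarith
  · rintro (hpq | ⟨rfl, h⟩)
    · nlinarith
    · omega

lemma exists_signedPerm_of_lexKey {n : ℕ} (P R : ℤ → ℤ)
    (hR : ∀ a : ℤ, 0 < a → a ≤ n → -(n : ℤ) ≤ R a ∧ R a ≤ n)
    (hinj : ∀ a b : ℤ, 0 < a → a ≤ n → 0 < b → b ≤ n → P a = P b → R a = R b → a = b)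
    (hneg : ∀ a b : ℤ, 0 < a → a ≤ n → 0 < b → b ≤ n → P a = -P b → R a ≠ -R b) :
    ∃ π : SignedPerm n, ∀ a b, inPM n a → inPM n b →
      (π.perm a < π.perm b ↔
        oddExt P a < oddExt P b ∨ oddExt P a = oddExt P b ∧ oddExt R a < oddExt R b) := by
  have hR' : ∀ a, inPM n a → -(n : ℤ) ≤ oddExt R a ∧ oddExt R a ≤ n := by
    intro a ha
    have h0 := ha.1
    have h1 := ha.2
    unfold oddExt
    split_ifs with h
    · exact hR a h h1.2
    · have := hR (-a) (by omega) (by omega)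
      omega
  have hodd : ∀ (Q : ℤ → ℤ) a, inPM n a → oddExt Q (-a) = -oddExt Q a := by
    intro Q a ha
    have h0 := ha.1
    unfold oddExt
    split_ifs
    · omega
    · rw [neg_neg]
    · rw [neg_neg]
    · omega
  have hlex := fun a b (ha : inPM n a) (hb : inPM n b) =>
    mul_add_lt_mul_add_iff_lex (p := oddExt P a) (q := oddExt P b) (hR' a ha).1 (hR' a ha).2
      (hR' b hb).1 (hR' b hb).2
  obtain ⟨π, hπ⟩ := exists_signedPerm_of_key (n := n)
    (fun a => (2 * (n : ℤ) + 1) * oddExt P a + oddExt R a)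
    (fun a ha => by
      simp only [hodd P a ha, hodd R a ha]
      ring)
    (fun a b ha hb hab => by
      have h1 := hlex a b ha hb
      have h2 := hlex b a hb ha
      have hP : oddExt P a = oddExt P b := by omega
      have hRR : oddExt R a = oddExt R b := by omega
      obtain ⟨ha0, ha1, ha2⟩ := ha
      obtain ⟨hb0, hb1, hb2⟩ := hb
      unfold oddExt at hP hRR
      split_ifs at hP hRR with h h'
      · exact hinj a b h ha2 h' hb2 hP hRR
      · exact absurd hRR (hneg a (-b) h ha2 (by omega) (by omega) hP)
      · exact absurd hRR.symm (hneg b (-a) (by omega) hb2 (by omega) (by omega) hP.symm)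
      · have := hinj (-a) (-b) (by omega) (by omega) (by omega) (by omega) (by omega) (by omega)
        omega)
  exact ⟨π, fun a b ha hb => (hπ a b ha hb).trans (hlex a b ha hb)⟩

/-- The canonical representatives `(i, k)` of the inversions with `i` and `k` in different
blocks of `Part(α)`. -/
def IsAdmissible {n : ℕ} (α : BComp n) (i k : ℤ) : Prop :=
  inPM n i ∧ inPM n k ∧ -k ≤ i ∧ i < k ∧ blockIdx α i ≠ blockIdx α k

lemma memH_of_canonical {n : ℕ} {α : BComp n} {π : SignedPerm n}
    (h : ∀ a b, inPM n a → inPM n b → -b ≤ a → a < b → π.perm b < π.perm a →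
      blockIdx α a ≠ blockIdx α b) : memH α π := by
  intro a b ha hb hab hB
  by_contra hc
  have hlt := lt_of_le_of_ne (not_lt.1 hc) (perm_ne π hab.ne')
  by_cases hba : -b ≤ a
  · exact h a b ha hb hba hab hlt hB
  · refine h (-b) (-a) hb.neg ha.neg (by omega) (by omega) ?_ ?_
    · rw [π.sign_symm, π.sign_symm]
      omega
    · rw [blockIdx_neg α ha.1, blockIdx_neg α hb.1, hB]

/-- The consequences of `231`-avoidance for a cover inversion `(i, k)` which determine the
smallest element having it. -/
def Forces {n : ℕ} (α : BComp n) (x : SignedPerm n) (i k : ℤ) : Prop :=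
  (0 ≤ blockIdx α i → ∀ j, 0 < j → j ≤ k → blockIdx α i < blockIdx α j →
    x.perm j ≤ x.perm k) ∧
  (blockIdx α i < 0 →
    (∀ j, 0 < j → j ≤ k → 0 < blockIdx α j → x.perm j ≤ x.perm k) ∧
    (∀ j, 0 < j → j ≤ -i → 0 < blockIdx α j → x.perm j ≤ x.perm (-i)) ∧
    (∀ j, 0 < j → j ≤ -i → blockIdx α j = 0 → x.perm i < x.perm j))

lemma memH.le {n : ℕ} {α : BComp n} {π : SignedPerm n} (h : memH α π) {a b : ℤ} (ha : inPM n a)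
    (hb : inPM n b) (hab : a ≤ b) (hB : blockIdx α a = blockIdx α b) :
    π.perm a ≤ π.perm b := by
  rcases eq_or_lt_of_le hab with rfl | hlt
  · exact le_rfl
  · exact (h a b ha hb hlt hB).le

lemma forces_of_mem231 {n : ℕ} (hn : 1 ≤ n) {α : BComp n} {x : SignedPerm n} {i k : ℤ}
    (hx : mem231 α x) (hc : IsAdmissible α i k) (hcov : IsCover x i k) : Forces α x i k := by
  obtain ⟨hi, hk, hki, hik, hB⟩ := hc
  have hBik := blockIdx_mono hn α hi.1 hk.1 hik.le
  have hno := fun h => hx.2 ((has231_iff hn α x).2 h)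
  have hk2 := hk.2.2
  have hle : ∀ j, 0 < j → j ≤ k → i < j → blockIdx α i < blockIdx α j → 0 < blockIdx α j →
      x.perm j ≤ x.perm k := by
    intro j h0 hjk hij h1 h2
    have hj : inPM n j := ⟨by omega, by omega, by omega⟩
    have h3 := blockIdx_mono hn α hj.1 hk.1 hjk
    rcases eq_or_lt_of_le h3 with h4 | h4
    · exact hx.1.le hj hk hjk h4
    · by_contra hlt
      have h5 := hcov.2 j hj
      have h6 := perm_ne x hij.ne
      have h7 : j ≠ k := by
        rintro rfl
        omega
      exact hno ⟨i, j, k, hi, hj, hk, hij, by omega, h0, h1, h4, hcov, fun _ => by omega,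
        fun _ => by omega⟩
  refine ⟨fun hBi j h0 hjk hBj => ?_, fun hBi => ⟨fun j h0 hjk hBj => ?_, fun j h0 hji hBj => ?_,
    fun j h0 hji hBj => ?_⟩⟩
  · have hij : i < j := by
      by_contra hc
      have := blockIdx_mono hn α (x := j) (by omega) hi.1 (by omega)
      omega
    exact hle j h0 hjk hij hBj (by omega)
  · have hi0 : i < 0 := by
      by_contra hc
      have := blockIdx_nonneg α (x := i) (by have := hi.1; omega)
      omega
    exact hle j h0 hjk (by omega) (by omega) hBj
  · have hj : inPM n j := ⟨by omega, by omega, by omega⟩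
    have hBi' := blockIdx_neg α hi.1
    have hBk' := blockIdx_neg α hk.1
    have hBk0 := blockIdx_nonneg α (x := k) (by omega)
    have h3 := blockIdx_mono hn α hj.1 hi.neg.1 hji
    rcases eq_or_lt_of_le h3 with h4 | h4
    · exact hx.1.le hj hi.neg hji h4
    · by_contra hlt
      have hcov' := hcov.neg
      have h5 := hcov'.2 j hj
      have h6 := perm_ne x (show -k ≠ j by omega)
      have h7 : j ≠ -i := by
        rintro rfl
        omega
      exact hno ⟨-k, j, -i, hk.neg, hj, hi.neg, by omega, by omega, h0, by omega, h4, hcov',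
        fun _ => by omega, fun _ => by omega⟩
  · have hj : inPM n j := ⟨by omega, by omega, by omega⟩
    have hBi' := blockIdx_neg α hi.1
    have h3 := blockIdx_mono hn α hi.neg.1 hk.1 (by omega)
    by_contra hlt
    have h5 := hcov.2 j hj
    have h6 := perm_ne x (show i ≠ j by omega)
    have h7 : j ≠ k := by
      rintro rfl
      omega
    have h8 := perm_ne x h7
    exact hno ⟨i, j, k, hi, hj, hk, by omega, by omega, h0, by omega, by omega, hcov,
      fun _ => by omega, fun _ => by omega⟩

/-- The inversions forced by the cover inversion `(i, k)`. -/
def ForcedInv {n : ℕ} (α : BComp n) (i k a b : ℤ) : Prop :=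
  b ≤ k ∧
  (0 ≤ blockIdx α i → blockIdx α i < blockIdx α b ∧
    (i ≤ a ∧ blockIdx α a = blockIdx α i ∨
      i < 0 ∧ a < 0 ∧ -a ≤ k ∧ blockIdx α i < -blockIdx α a)) ∧
  (blockIdx α i < 0 → 0 < blockIdx α b ∧
    (0 < a ∧ blockIdx α a = 0 ∨ i ≤ a ∧ a < 0 ∧ blockIdx α a < 0))

lemma ForcedInv.blockIdx_ne {n : ℕ} {α : BComp n} {i k a b : ℤ} (h : ForcedInv α i k a b) :
    blockIdx α a ≠ blockIdx α b := by
  obtain ⟨-, h1, h2⟩ := h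
  rcases lt_or_ge (blockIdx α i) 0 with h | h
  · have := h2 h
    omega
  · have := h1 h
    omega

lemma ForcedInv.le {n : ℕ} (hn : 1 ≤ n) {α : BComp n} {i k a b : ℤ} {x : SignedPerm n}
    (hc : IsAdmissible α i k) (ha : inPM n a) (hba : -b ≤ a) (hab : a < b)
    (h : ForcedInv α i k a b) (hx : memH α x) (hcov : IsCover x i k) (hf : Forces α x i k) :
    x.perm i ≤ x.perm a ∧ x.perm b ≤ x.perm k := by
  obtain ⟨hi, hk, hki, hik, hB⟩ := hc
  obtain ⟨hbk, h1, h2⟩ := h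
  have hcov1 := hcov.1
  have hBa := blockIdx_neg α ha.1
  have hxa := x.sign_symm a
  have hxi := x.sign_symm i
  rcases lt_or_ge (blockIdx α i) 0 with hBi | hBi
  · obtain ⟨f1, f2, f3⟩ := hf.2 hBi
    obtain ⟨g1, g2⟩ := h2 hBi
    refine ⟨?_, f1 b (by omega) hbk g1⟩
    rcases g2 with ⟨g2, g3⟩ | ⟨g2, g3, g4⟩
    · refine (f3 a g2 ?_ g3).le
      by_contra hlt
      have := blockIdx_mono hn α hi.neg.1 ha.1 (by omega)
      rw [blockIdx_neg α hi.1] at this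
      omega
    · have := f2 (-a) (by omega) (by omega) (by omega)
      omega
  · have f1 := hf.1 hBi
    obtain ⟨g1, g2⟩ := h1 hBi
    have hb := f1 b (by omega) hbk g1
    refine ⟨?_, hb⟩
    rcases g2 with ⟨g2, g3⟩ | ⟨g2, g3, g4, g5⟩
    · exact hx.le hi ha g2 g3.symm
    · have := f1 (-a) (by omega) g4 (by omega)
      have hm := blockIdx_mono hn α hi.1 hi.neg.1 (by omega)
      rw [blockIdx_neg α hi.1] at hm
      have := hx i (-i) hi hi.neg (by omega) (by rw [blockIdx_neg α hi.1]; omega)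
      omega

lemma exists_forced_of_nonneg {n : ℕ} (hn : 1 ≤ n) {α : BComp n} {i k : ℤ}
    (hc : IsAdmissible α i k) (hBi : 0 ≤ blockIdx α i) :
    ∃ y : SignedPerm n, IsCover y i k ∧ Forces α y i k ∧
      ∀ a b, inPM n a → inPM n b → -b ≤ a → a < b → y.perm b < y.perm a →
        ForcedInv α i k a b := by
  obtain ⟨hi, hk, hki, hik, hB⟩ := hc
  have hBik := blockIdx_mono hn α hi.1 hk.1 hik.le
  have hi0 := hi.1
  have hk2 := hk.2.2
  obtain ⟨y, hy⟩ := exists_signedPerm_of_lexKey (n := n)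
    (fun a => if blockIdx α i < blockIdx α a ∧ a ≤ k then i - 1 else a)
    (fun a => if blockIdx α i < blockIdx α a ∧ a ≤ k then a else 0)
    (fun a _ _ => by split_ifs <;> omega)
    (fun a b _ _ _ _ h h' => by split_ifs at h h' <;> omega)
    (fun a b _ _ _ _ h => by split_ifs at * <;> omega)
  have hBi' := blockIdx_neg α hi.1
  have hineg : i < 0 → blockIdx α i = 0 := fun h => by
    have := blockIdx_mono hn α hi.1 hi.neg.1 (by omega)
    omega
  refine ⟨y, ⟨?_, fun m hm hlt => ?_⟩, ⟨fun _ j h0 hjk hBj => ?_, fun h => by omega⟩, ?_⟩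
  · rw [hy k i hk hi]
    simp only [oddExt, hBi']
    split_ifs <;> omega
  · rw [hy k m hk hm, hy m i hm hi] at hlt
    have hm0 := hm.1
    simp only [oddExt, hBi'] at hlt
    split_ifs at hlt <;> omega
  · have hj : inPM n j := ⟨by omega, by omega, by omega⟩
    rw [← not_lt, hy k j hk hj]
    simp only [oddExt]
    split_ifs <;> omega
  · intro a b ha hb hba hab hlt
    rw [hy b a hb ha] at hlt
    have ha0 := ha.1
    have hBa := blockIdx_neg α ha.1
    have m1 := blockIdx_mono hn α ha.1 hb.1 hab.le
    have m2 : i ≤ a → blockIdx α i ≤ blockIdx α a := blockIdx_mono hn α hi.1 ha.1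
    have m3 : a ≤ -i → blockIdx α a ≤ blockIdx α (-i) := blockIdx_mono hn α ha.1 hi.neg.1
    have m4 : -a ≤ -i → blockIdx α (-a) ≤ blockIdx α (-i) := blockIdx_mono hn α ha.neg.1 hi.neg.1
    simp only [oddExt, hBa] at hlt
    refine ⟨?_, fun _ => ?_, fun h => by omega⟩
    · split_ifs at hlt <;> omega
    · split_ifs at hlt <;> omega

lemma exists_forced_of_neg {n : ℕ} (hn : 1 ≤ n) {α : BComp n} {i k : ℤ}
    (hc : IsAdmissible α i k) (hBi : blockIdx α i < 0) :
    ∃ y : SignedPerm n, IsCover y i k ∧ Forces α y i k ∧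
      ∀ a b, inPM n a → inPM n b → -b ≤ a → a < b → y.perm b < y.perm a →
        ForcedInv α i k a b := by
  obtain ⟨hi, hk, hki, hik, hB⟩ := hc
  have hi0 := hi.1
  have hk2 := hk.2.2
  have hi_neg : i < 0 := by
    by_contra hc
    have := blockIdx_nonneg α (x := i) (by omega)
    omega
  have hk0 : 0 < k := by omega
  have hi1 : 0 < -i := by omega
  have hBi' := blockIdx_neg α hi.1
  have hBk := blockIdx_mono hn α hi.neg.1 hk.1 (by omega)
  obtain ⟨P, hP⟩ : ∃ P : ℤ → ℤ, ∀ a, (0 < blockIdx α a ∧ a ≤ -i ∧ P a = -k) ∨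
      (0 < blockIdx α a ∧ -i < a ∧ a ≤ k ∧ P a = 0) ∨
      (0 < blockIdx α a ∧ k < a ∧ P a = a) ∨ (blockIdx α a ≤ 0 ∧ P a = k) := by
    refine ⟨fun a => if 0 < blockIdx α a then (if a ≤ -i then -k else if a ≤ k then 0 else a)
      else k, fun a => ?_⟩
    dsimp only
    split_ifs <;> omega
  obtain ⟨R, hR⟩ : ∃ R : ℤ → ℤ, ∀ a, (0 < blockIdx α a ∧ k < a ∧ R a = 0) ∨
      ((blockIdx α a ≤ 0 ∨ a ≤ k) ∧ R a = a) := by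
    refine ⟨fun a => if 0 < blockIdx α a ∧ k < a then 0 else a, fun a => ?_⟩
    dsimp only
    split_ifs <;> omega
  obtain ⟨y, hy⟩ := exists_signedPerm_of_lexKey (n := n) P R
    (fun a _ _ => by have := hR a; omega)
    (fun a b _ _ _ _ h h' => by have := hP a; have := hP b; have := hR a; have := hR b; omega)
    (fun a b _ _ _ _ h h' => by have := hP a; have := hP b; have := hR a; have := hR b; omega)
  have hPi := hP (-i)
  have hPk := hP k
  have hRi := hR (-i)
  have hRk := hR k
  refine ⟨y, ⟨?_, fun m hm hlt => ?_⟩,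
    ⟨fun h => by omega, fun _ => ⟨fun j h0 hjk hBj => ?_, fun j h0 hjk hBj => ?_,
      fun j h0 hjk hBj => ?_⟩⟩, ?_⟩
  · rw [hy k i hk hi, oddExt_of_pos hk0, oddExt_of_pos hk0, oddExt_of_neg hi_neg,
      oddExt_of_neg hi_neg]
    omega
  · rw [hy k m hk hm, hy m i hm hi, oddExt_of_pos hk0, oddExt_of_pos hk0, oddExt_of_neg hi_neg,
      oddExt_of_neg hi_neg] at hlt
    have hBm := blockIdx_neg α hm.1
    rcases lt_or_gt_of_ne hm.1 with hm0 | hm0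
    · rw [oddExt_of_neg hm0, oddExt_of_neg hm0] at hlt
      have := hP (-m)
      have := hR (-m)
      omega
    · rw [oddExt_of_pos hm0, oddExt_of_pos hm0] at hlt
      have := hP m
      have := hR m
      omega
  · rw [← not_lt, hy k j hk ⟨by omega, by omega, by omega⟩, oddExt_of_pos hk0, oddExt_of_pos hk0,
      oddExt_of_pos h0, oddExt_of_pos h0]
    have := hP j
    have := hR j
    omega
  · rw [← not_lt, hy (-i) j hi.neg ⟨by omega, by omega, by omega⟩, oddExt_of_pos hi1,
      oddExt_of_pos hi1, oddExt_of_pos h0, oddExt_of_pos h0]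
    have := hP j
    have := hR j
    omega
  · rw [hy i j hi ⟨by omega, by omega, by omega⟩, oddExt_of_neg hi_neg, oddExt_of_neg hi_neg,
      oddExt_of_pos h0, oddExt_of_pos h0]
    have := hP j
    have := hR j
    omega
  · intro a b ha hb hba hab hlt
    have hb0 : 0 < b := by omega
    rw [hy b a hb ha, oddExt_of_pos hb0, oddExt_of_pos hb0] at hlt
    have hBa := blockIdx_neg α ha.1
    have hPb := hP b
    have hRb := hR b
    have m1 := blockIdx_mono hn α ha.1 hb.1 hab.le
    rcases lt_or_gt_of_ne ha.1 with ha0 | ha0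
    · rw [oddExt_of_neg ha0, oddExt_of_neg ha0] at hlt
      have hPa := hP (-a)
      have hRa := hR (-a)
      have m2 := blockIdx_mono hn α ha.neg.1 hb.1 (by omega)
      have m3 := blockIdx_nonneg α hb0
      exact ⟨by omega, fun h => by omega, fun _ => by omega⟩
    · rw [oddExt_of_pos ha0, oddExt_of_pos ha0] at hlt
      have hPa := hP a
      have hRa := hR a
      have m3 := blockIdx_nonneg α ha0
      exact ⟨by omega, fun h => by omega, fun _ => by omega⟩

lemma IsAdmissible.eq_of_isCover {n : ℕ} {α : BComp n} {i k a b : ℤ} {x : SignedPerm n}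
    (hc : IsAdmissible α i k) (h : IsCover x a b) (hcov : IsCover x i k)
    (hle : x.perm i ≤ x.perm a ∧ x.perm b ≤ x.perm k) : a = i ∧ b = k := by
  have h1 := h.2 i hc.1
  have h2 := h.2 k hc.2.1
  have h3 := hcov.1
  exact ⟨x.perm.injective (by omega), x.perm.injective (by omega)⟩

/-- `y` is the smallest element of `H_α(231)` having `(i, k)` as a cover inversion; moreover the
inversions of `y` are located around the values at `i` and `k` in every such element. -/
def IsLeastCover {n : ℕ} (α : BComp n) (i k : ℤ) (y : SignedPerm n) : Prop :=
  mem231 α y ∧ IsCover y i k ∧ ∀ x, mem231 α x → IsCover x i k →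
    ∀ a b, inPM n a → inPM n b → -b ≤ a → a < b → y.perm b < y.perm a →
      x.perm i ≤ x.perm a ∧ x.perm b ≤ x.perm k

lemma exists_isLeastCover {n : ℕ} (hn : 1 ≤ n) {α : BComp n} {i k : ℤ}
    (hc : IsAdmissible α i k) : ∃ y, IsLeastCover α i k y := by
  obtain ⟨y, hcov, hf, hinv⟩ : ∃ y : SignedPerm n, IsCover y i k ∧ Forces α y i k ∧
      ∀ a b, inPM n a → inPM n b → -b ≤ a → a < b → y.perm b < y.perm a →
        ForcedInv α i k a b := by
    rcases lt_or_ge (blockIdx α i) 0 with h | h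
    · exact exists_forced_of_neg hn hc h
    · exact exists_forced_of_nonneg hn hc h
  have hy : memH α y := memH_of_canonical fun a b ha hb hba hab hlt =>
    (hinv a b ha hb hba hab hlt).blockIdx_ne
  refine ⟨y, ⟨hy, fun h => ?_⟩, hcov, fun x hx hxc a b ha hb hba hab hlt =>
    (hinv a b ha hb hba hab hlt).le hn hc ha hba hab hx.1 hxc (forces_of_mem231 hn hx hc hxc)⟩
  obtain ⟨i', j, k', hi', hj, hk', hij, hjk, h0, hB1, hB2, hc', h1, h2⟩ := (has231_iff hn α y).1 h
  have hlt := hcov.1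
  have hBj := blockIdx_nonneg α h0
  have heq : ∀ a b, inPM n a → inPM n b → -b ≤ a → a < b → IsCover y a b → a = i ∧ b = k :=
    fun a b ha hb hba hab hcab => hc.eq_of_isCover hcab hcov
      ((hinv a b ha hb hba hab hcab.1).le hn hc ha hba hab hy hcov hf)
  obtain ⟨hi, hk, hki, hik, hB⟩ := hc
  have hBi := blockIdx_neg α hi.1
  by_cases hki' : -k' ≤ i'
  · obtain ⟨rfl, rfl⟩ := heq i' k' hi' hk' hki' (by omega) hc'
    rcases lt_or_ge (blockIdx α i') 0 with hneg | hneg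
    · obtain ⟨f1, f2, f3⟩ := hf.2 hneg
      rcases eq_or_lt_of_le hBj with hBj | hBj
      · have hji : j ≤ -i' := by
          by_contra hc
          have := blockIdx_mono hn α hi'.neg.1 hj.1 (by omega)
          omega
        have := f3 j h0 hji hBj.symm
        have := h2 hBj.symm
        omega
      · have := f1 j h0 hjk.le hBj
        have := h1 hBj
        omega
    · have := hf.1 hneg j h0 hjk.le hB1
      have := h1 (by omega)
      omega
  · obtain ⟨hik1, hik2⟩ := heq (-k') (-i') hk'.neg hi'.neg (by omega) (by omega) hc'.neg
    obtain rfl : k' = -i := by omega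
    obtain rfl : i' = -k := by omega
    obtain ⟨f1, f2, f3⟩ := hf.2 (by omega)
    have hc1 := hc'.1
    rcases eq_or_lt_of_le hBj with hBj | hBj
    · have := f3 j h0 hjk.le hBj.symm
      have := f1 (-i) (by omega) (by omega) (by omega)
      have := h2 hBj.symm
      omega
    · have := f2 j h0 hjk.le hBj
      have := h1 hBj
      omega

lemma IsLeastCover.wle_of_isCover {n : ℕ} {α : BComp n} {i k : ℤ} {x y : SignedPerm n}
    (h : IsLeastCover α i k y) (hx : mem231 α x) (hxc : IsCover x i k) : wle y x :=
  wle_iff_canonical.2 fun a b ha hb hba hab hlt => by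
    have := h.2.2 x hx hxc a b ha hb hba hab hlt
    have := hxc.1
    omega

lemma IsLeastCover.eq_of_isCover {n : ℕ} {α : BComp n} {i k a b : ℤ} {x y : SignedPerm n}
    (hc : IsAdmissible α i k) (h : IsLeastCover α i k y) (hx : mem231 α x) (hxc : IsCover x i k)
    (ha : inPM n a) (hb : inPM n b) (hba : -b ≤ a) (hab : a < b) (hab' : IsCover x a b)
    (hlt : y.perm b < y.perm a) : a = i ∧ b = k :=
  hc.eq_of_isCover hab' hxc (h.2.2 x hx hxc a b ha hb hba hab hlt)

lemma isAdmissible_or_neg {n : ℕ} {α : BComp n} {x : SignedPerm n} (hx : memH α x) {a b : ℤ}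
    (ha : inPM n a) (hb : inPM n b) (hab : a < b) (hlt : x.perm b < x.perm a) :
    IsAdmissible α a b ∨ IsAdmissible α (-b) (-a) := by
  have hB : blockIdx α a ≠ blockIdx α b := fun h => by
    have := hx a b ha hb hab h
    omega
  by_cases hba : -b ≤ a
  · exact Or.inl ⟨ha, hb, hba, hab, hB⟩
  · refine Or.inr ⟨hb.neg, ha.neg, by omega, by omega, ?_⟩
    rw [blockIdx_neg α hb.1, blockIdx_neg α ha.1]
    omega

lemma lt_of_wle_between {n : ℕ} {x y z : SignedPerm n} {m m' a b : ℤ} (hyx : wle y x)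
    (hyz : wle y z) (hm : inPM n m) (hm' : inPM n m') (hlt : y.perm m' < y.perm m)
    (ha : inPM n a) (hb : inPM n b) (hma : m ≤ a) (hab : a < b) (hbm : b ≤ m')
    (hxb : x.perm b ≤ x.perm m') (hxa : x.perm m ≤ x.perm a) : z.perm b < z.perm a := by
  refine wle_iff.1 hyz a b ha hb hab ?_
  have h1 : y.perm m ≤ y.perm a := by
    rcases eq_or_lt_of_le hma with rfl | h
    · exact le_rfl
    · by_contra hc
      have := wle_iff.1 hyx m a hm ha h (by omega)
      omega
  have h2 : y.perm b ≤ y.perm m' := by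
    rcases eq_or_lt_of_le hbm with rfl | h
    · exact le_rfl
    · by_contra hc
      have := wle_iff.1 hyx b m' hb hm' h (by omega)
      omega
  omega

/-- An element of `H_α(231)` is the join of the least elements attached to its covers. -/
lemma wle_of_forall_isLeastCover {n : ℕ} (hn : 1 ≤ n) {α : BComp n} {x z : SignedPerm n}
    (hx : mem231 α x)
    (h : ∀ i k y, IsAdmissible α i k → IsCover x i k → IsLeastCover α i k y → wle y z) :
    wle x z := by
  refine wle_of_forall_isCover fun m m' hm hm' hmm hcov a b ha hb hma hab hbm hxb hxa => ?_
  rcases isAdmissible_or_neg hx.1 hm hm' hmm hcov.1 with hc | hc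
  · obtain ⟨y, hy⟩ := exists_isLeastCover hn hc
    exact lt_of_wle_between (hy.wle_of_isCover hx hcov) (h _ _ y hc hcov hy) hm hm' hy.2.1.1 ha hb hma hab
      hbm hxb hxa
  · obtain ⟨y, hy⟩ := exists_isLeastCover hn hc
    have hlt := hy.2.1.neg.1
    rw [neg_neg, neg_neg] at hlt
    exact lt_of_wle_between (hy.wle_of_isCover hx hcov.neg) (h _ _ y hc hcov.neg hy) hm hm' hlt ha hb hma
      hab hbm hxb hxa

/-- The identity. -/
def SignedPerm.id (n : ℕ) : SignedPerm n := ⟨1, fun _ => rfl, fun _ _ => rfl⟩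

lemma id_mem231 {n : ℕ} (hn : 1 ≤ n) (α : BComp n) : mem231 α (SignedPerm.id n) := by
  refine ⟨fun a b _ _ hab _ => hab, fun h => ?_⟩
  obtain ⟨i, j, k, -, -, -, hij, hjk, -, -, -, hc, -, -⟩ := (has231_iff hn α _).1 h
  have : k < i := hc.1
  omega

/-- Removing a cover inversion `(i, k)` from `x` and projecting to `H_α(231)` gives the largest
element below `x` which does not have the inversion `(i, k)`. -/
lemma exists_largest_without {n : ℕ} (hn : 1 ≤ n) {α : BComp n} {x : SignedPerm n} {i k : ℤ}
    (hx : mem231 α x) (hi : inPM n i) (hk : inPM n k) (hik : i < k) (hcov : IsCover x i k) :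
    ∃ d, mem231 α d ∧ wle d x ∧ ¬ d.perm k < d.perm i ∧
      ∀ z, mem231 α z → wle z x → ¬ z.perm k < z.perm i → wle z d := by
  obtain ⟨σ, hσ⟩ := exists_swap x hi hk hik hcov
  have hσx : wle σ x := wle_iff.2 fun a b ha hb hab hlt => ((hσ a b ha hb hab).1 hlt).1
  obtain ⟨d, hd, hdσ, hmax⟩ := exists_isProjDown hn α σ (memH_of_wle hx.1 hσx)
  refine ⟨d, hd, hdσ.trans hσx, fun hlt => ?_, fun z hz hzx hzc => hmax z hz ?_⟩
  · exact ((hσ i k hi hk hik).1 (wle_iff.1 hdσ i k hi hk hik hlt)).2.1 ⟨rfl, rfl⟩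
  · refine wle_iff.2 fun a b ha hb hab hlt =>
      (hσ a b ha hb hab).2 ⟨wle_iff.1 hzx a b ha hb hab hlt, ?_, ?_⟩
    · rintro ⟨rfl, rfl⟩
      exact hzc hlt
    · rintro ⟨rfl, rfl⟩
      rw [z.sign_symm, z.sign_symm] at hlt
      omega

lemma IsLeastCover.joinIrred {n : ℕ} (hn : 1 ≤ n) {α : BComp n} {i k : ℤ} {x : SignedPerm n}
    (hc : IsAdmissible α i k) (h : IsLeastCover α i k x) : joinIrred α x := by
  obtain ⟨hx, hcov, -⟩ := id h
  have hi := hc.1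
  have hk := hc.2.1
  have hik := hc.2.2.2.1
  refine ⟨hx, fun hle => ?_, fun y z hy hz hj => ?_⟩
  · have hlt : k < i := wle_iff.1 (hle _ (id_mem231 hn α)) i k hi hk hik hcov.1
    omega
  · have key : ∀ y, mem231 α y → wle y x → x ≠ y → ¬ y.perm k < y.perm i := by
      intro y hy hyx hne hlt
      refine hne (wle.antisymm (wle_of_forall_isCover
        fun m m' hm hm' hmm hcm a b ha hb hma hab hbm hxb hxa => ?_) hyx)
      have : y.perm m' < y.perm m := by
        rcases isAdmissible_or_neg hx.1 hm hm' hmm hcm.1 with hcc | hcc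
        · obtain ⟨rfl, rfl⟩ := h.eq_of_isCover hc hx hcov hm hm' hcc.2.2.1 hmm hcm hcm.1
          exact hlt
        · obtain ⟨h1, h2⟩ := h.eq_of_isCover hc hx hcov hm'.neg hm.neg hcc.2.2.1 (by omega)
            hcm.neg hcm.neg.1
          rw [← h1, ← h2, y.sign_symm, y.sign_symm] at hlt
          omega
      exact lt_of_wle_between hyx wle_rfl hm hm' this ha hb hma hab hbm hxb hxa
    by_contra hne
    rw [not_or] at hne
    obtain ⟨d, hd, hdx, hdc, hmax⟩ := exists_largest_without hn hx hi hk hik hcov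
    obtain ⟨-, hyx, hzx, hlub⟩ := hj
    have hxd := hlub d hd (hmax y hy hyx (key y hy hyx hne.1)) (hmax z hz hzx (key z hz hzx hne.2))
    exact hdc (wle_iff.1 hxd i k hi hk hik hcov.1)

lemma exists_isLeastCover_of_joinIrred {n : ℕ} (hn : 1 ≤ n) {α : BComp n} {x : SignedPerm n}
    (h : joinIrred α x) : ∃ i k, IsAdmissible α i k ∧ IsLeastCover α i k x := by
  obtain ⟨hx, hbot, hji⟩ := h
  obtain ⟨i, k, y, hc, hcov, hy⟩ : ∃ i k y, IsAdmissible α i k ∧ IsCover x i k ∧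
      IsLeastCover α i k y := by
    by_contra! hno
    exact hbot fun z hz => wle_of_forall_isLeastCover hn hx fun i k y hc hcov hy =>
      absurd hy (hno i k y hc hcov)
  refine ⟨i, k, hc, ?_⟩
  obtain rfl | hne := eq_or_ne x y
  · exact hy
  obtain ⟨i', k', y', hc', hcov', hy', hne'⟩ : ∃ i' k' y', IsAdmissible α i' k' ∧
      IsCover x i' k' ∧ IsLeastCover α i' k' y' ∧ ¬ (i' = i ∧ k' = k) := by
    by_contra! hno
    refine hne (wle.antisymm (wle_of_forall_isLeastCover hn hx
      fun i' k' y' hc' hcov' hy' => ?_) (hy.wle_of_isCover hx hcov))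
    obtain ⟨rfl, rfl⟩ := hno i' k' y' hc' hcov' hy'
    exact hy'.wle_of_isCover hy.1 hy.2.1
  obtain ⟨d, hd, hdx, hdc, hmax⟩ := exists_largest_without hn hx hc.1 hc.2.1 hc.2.2.2.1 hcov
  obtain ⟨d', hd', hdx', hdc', hmax'⟩ :=
    exists_largest_without hn hx hc'.1 hc'.2.1 hc'.2.2.2.1 hcov'
  have hjoin : isJoinIn (Tset α) d d' x := by
    refine ⟨hx, hdx, hdx', fun z _ hdz hdz' =>
      wle_of_forall_isLeastCover hn hx fun p q w hpq hcpq hw => ?_⟩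
    have hwx := hw.wle_of_isCover hx hcpq
    have huniq : ∀ a b, IsAdmissible α a b → IsCover x a b → ¬ (a = p ∧ b = q) →
        ¬ w.perm b < w.perm a := fun a b hab hcab hne hlt =>
      hne (hw.eq_of_isCover hpq hx hcpq hab.1 hab.2.1 hab.2.2.1 hab.2.2.2.1 hcab hlt)
    by_cases hik : i = p ∧ k = q
    · exact (hmax' w hw.1 hwx (huniq i' k' hc' hcov' fun h =>
        hne' ⟨h.1.trans hik.1.symm, h.2.trans hik.2.symm⟩)).trans hdz'
    · exact (hmax w hw.1 hwx (huniq i k hc hcov hik)).trans hdz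
  rcases hji d d' hd hd' hjoin with rfl | rfl
  · exact absurd hcov.1 hdc
  · exact absurd hcov'.1 hdc'

lemma IsLeastCover.unique {n : ℕ} {α : BComp n} {i k : ℤ} {x y : SignedPerm n}
    (hx : IsLeastCover α i k x) (hy : IsLeastCover α i k y) : x = y :=
  wle.antisymm (hx.wle_of_isCover hy.1 hy.2.1) (hy.wle_of_isCover hx.1 hx.2.1)

lemma IsLeastCover.pair_unique {n : ℕ} {α : BComp n} {i k i' k' : ℤ} {x : SignedPerm n}
    (hc : IsAdmissible α i k) (hc' : IsAdmissible α i' k') (hx : IsLeastCover α i k x)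
    (hx' : IsLeastCover α i' k' x) : i = i' ∧ k = k' :=
  hx'.eq_of_isCover hc' hx.1 hx'.2.1 hc.1 hc.2.1 hc.2.2.1 hc.2.2.2.1 hx.2.1 hx.2.1.1

open Classical in
lemma ncard_joinIrred {n : ℕ} (hn : 1 ≤ n) (α : BComp n) :
    {x : SignedPerm n | joinIrred α x}.ncard =
      ((pmFinset n ×ˢ pmFinset n).filter fun c => IsAdmissible α c.1 c.2).card := by
  symm
  rw [← Set.ncard_coe_finset]
  refine Set.ncard_congr
    (fun c hc => (exists_isLeastCover hn (α := α) (Finset.mem_filter.1 hc).2).choose) ?_ ?_ ?_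
  · intro c hc
    exact IsLeastCover.joinIrred hn (Finset.mem_filter.1 hc).2
      (exists_isLeastCover hn (Finset.mem_filter.1 hc).2).choose_spec
  · intro c c' hc hc' h
    have h1 := (exists_isLeastCover hn (Finset.mem_filter.1 hc).2).choose_spec
    have h2 := (exists_isLeastCover hn (Finset.mem_filter.1 hc').2).choose_spec
    rw [← h] at h2
    exact Prod.ext_iff.2 (h1.pair_unique (Finset.mem_filter.1 hc).2 (Finset.mem_filter.1 hc').2 h2)
  · intro x hx
    obtain ⟨i, k, hc, h⟩ := exists_isLeastCover_of_joinIrred hn hx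
    exact ⟨(i, k), Finset.mem_filter.2 ⟨Finset.mem_product.2
      ⟨mem_pmFinset.2 hc.1, mem_pmFinset.2 hc.2.1⟩, hc⟩,
      (exists_isLeastCover hn hc).choose_spec.unique h⟩

/-! ### Counting the admissible pairs -/

/-- The region of `a` with respect to a list of parts. -/
def listRegion (L : List ℕ) (a : ℕ) : ℕ :=
  ((Finset.range L.length).filter (fun j => (L.take j).sum < a)).card

lemma listRegion_zero (L : List ℕ) : listRegion L 0 = 0 := by
  simp [listRegion]

lemma listRegion_cons (p : ℕ) (L : List ℕ) (a : ℕ) :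
    listRegion (p :: L) a = (if 0 < a then 1 else 0) + listRegion L (a - p) := by
  unfold listRegion
  simp only [Finset.card_filter, List.length_cons, Finset.sum_range_succ', List.take_succ_cons,
    List.sum_cons, List.take_zero, List.sum_nil, lt_tsub_iff_left]
  exact Nat.add_comm _ _

lemma listRegion_pos {L : List ℕ} {a : ℕ} (ha : 0 < a) (haL : a ≤ L.sum) :
    0 < listRegion L a := by
  cases L with
  | nil => simp at haL; omega
  | cons p L =>
    rw [listRegion_cons, if_pos ha]
    omega

lemma sum_card_listRegion_eq (L : List ℕ) :
    ∑ k ∈ Finset.range L.sum,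
        ((Finset.range k).filter fun i => listRegion L (i + 1) = listRegion L (k + 1)).card =
      (L.map fun a => a * (a - 1) / 2).sum := by
  induction L with
  | nil => simp
  | cons p L ih =>
    rw [List.sum_cons, Finset.sum_range_add, List.map_cons, List.sum_cons, ← ih,
      ← Finset.sum_range_id]
    congr 1
    · refine Finset.sum_congr rfl fun k hk => ?_
      rw [Finset.mem_range] at hk
      rw [Finset.filter_true_of_mem, Finset.card_range]
      intro i hi
      rw [Finset.mem_range] at hi
      rw [listRegion_cons, listRegion_cons, Nat.sub_eq_zero_of_le (by omega : i + 1 ≤ p),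
        Nat.sub_eq_zero_of_le (by omega : k + 1 ≤ p), if_pos (by omega), if_pos (by omega)]
    · refine Finset.sum_congr rfl fun k hk => ?_
      rw [Finset.mem_range] at hk
      have hpos := listRegion_pos (L := L) (a := k + 1) (by omega) (by omega)
      refine Finset.card_nbij' (fun i => i - p) (fun i => p + i) ?_ ?_ ?_ ?_
      · intro i hi
        simp only [Finset.coe_filter, Finset.mem_range, Set.mem_ofPred_eq, listRegion_cons] at hi ⊢
        obtain ⟨h1, h2⟩ := hi
        rw [if_pos (by omega), if_pos (by omega), show p + k + 1 - p = k + 1 by omega] at h2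
        have hpi : p ≤ i := by
          by_contra hlt
          rw [Nat.sub_eq_zero_of_le (by omega : i + 1 ≤ p), listRegion_zero] at h2
          omega
        rw [show i - p + 1 = i + 1 - p by omega]
        omega
      · intro i hi
        simp only [Finset.coe_filter, Finset.mem_range, Set.mem_ofPred_eq, listRegion_cons] at hi ⊢
        rw [if_pos (by omega), if_pos (by omega), show p + k + 1 - p = k + 1 by omega,
          show p + i + 1 - p = i + 1 by omega]
        omega
      · intro i hi
        simp only [Finset.coe_filter, Finset.mem_range, Set.mem_ofPred_eq, listRegion_cons] at hi
        obtain ⟨h1, h2⟩ := hi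
        rw [if_pos (by omega), if_pos (by omega), show p + k + 1 - p = k + 1 by omega] at h2
        have hpi : p ≤ i := by
          by_contra hlt
          rw [Nat.sub_eq_zero_of_le (by omega : i + 1 ≤ p), listRegion_zero] at h2
          omega
        dsimp only
        omega
      · intro i hi
        dsimp only
        omega

lemma blockIdx_eq_iff_of_pos {n : ℕ} (hn : 1 ≤ n) (α : BComp n) {a b : ℕ} (ha : 0 < a)
    (hb : 0 < b) : blockIdx α a = blockIdx α b ↔ region α a = region α b := by
  rw [blockIdx_of_pos α (by omega), blockIdx_of_pos α (by omega), Int.toNat_natCast,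
    Int.toNat_natCast]
  have h1 := region_pos hn α ha
  have h2 := region_pos hn α hb
  by_cases hα : α.isJoin = true
  · simp only [hα, true_and]
    split_ifs <;> omega
  · simp only [hα, false_and, if_false, Nat.cast_inj, Bool.false_eq_true]

open Classical in
lemma card_isAdmissible_right {n : ℕ} (hn : 1 ≤ n) (α : BComp n) {k : ℕ} (hk : k < n) :
    ((pmFinset n).filter fun i => IsAdmissible α i ((k : ℤ) + 1)).card +
      ((Finset.range k).filter fun i => region α (i + 1) = region α (k + 1)).card +
      (if α.isJoin = true ∧ k < alpha1 α then k + 1 else 0) = 2 * k + 1 := by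
  have hkn : inPM n ((k : ℤ) + 1) := ⟨by omega, by omega, by omega⟩
  set U := (Finset.Ico (-((k : ℤ) + 1)) (k + 1)).erase 0 with hU
  have hUcard : U.card = 2 * k + 1 := by
    rw [hU, Finset.card_erase_of_mem (Finset.mem_Ico.2 (by omega)), Int.card_Ico]
    omega
  have hA : (pmFinset n).filter (fun i => IsAdmissible α i ((k : ℤ) + 1)) =
      U.filter fun i => ¬ blockIdx α i = blockIdx α ((k : ℤ) + 1) := by
    ext i
    rw [Finset.mem_filter, Finset.mem_filter, mem_pmFinset, hU, Finset.mem_erase, Finset.mem_Ico]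
    constructor
    · rintro ⟨-, h, -, h1, h2, h3⟩
      exact ⟨⟨h.1, h1, h2⟩, h3⟩
    · rintro ⟨⟨h0, h1, h2⟩, h3⟩
      have h : inPM n i := ⟨h0, by omega, by omega⟩
      exact ⟨h, h, hkn, h1, h2, h3⟩
  have hpos : ((U.filter fun i => blockIdx α i = blockIdx α ((k : ℤ) + 1)).filter
        fun i => 0 < i).card =
      ((Finset.range k).filter fun i => region α (i + 1) = region α (k + 1)).card := by
    have hiff : ∀ i : ℕ, blockIdx α ((i : ℤ) + 1) = blockIdx α ((k : ℤ) + 1) ↔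
        region α (i + 1) = region α (k + 1) := fun i => by
      rw [← blockIdx_eq_iff_of_pos hn α (by omega) (by omega)]
      push_cast
      rfl
    refine Finset.card_nbij' (fun i => (i - 1).toNat) (fun i => (i : ℤ) + 1) ?_ ?_ ?_ ?_
    · intro i hi
      simp only [hU, Finset.coe_filter, Finset.mem_filter, Finset.mem_erase, Finset.mem_Ico,
        Set.mem_ofPred_eq, Finset.mem_range] at hi ⊢
      obtain ⟨⟨⟨-, -, h1⟩, h2⟩, h3⟩ := hi
      refine ⟨by omega, (hiff _).1 ?_⟩
      rwa [show (((i - 1).toNat : ℤ)) + 1 = i by omega]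
    · intro i hi
      simp only [hU, Finset.coe_filter, Finset.mem_filter, Finset.mem_erase, Finset.mem_Ico,
        Set.mem_ofPred_eq, Finset.mem_range] at hi ⊢
      exact ⟨⟨⟨by omega, by omega, by omega⟩, (hiff i).2 hi.2⟩, by omega⟩
    · intro i hi
      have := (Finset.mem_filter.1 hi).2
      dsimp only
      omega
    · intro i hi
      dsimp only
      omega
  have hneg : ((U.filter fun i => blockIdx α i = blockIdx α ((k : ℤ) + 1)).filter
        fun i => ¬ 0 < i).card = if α.isJoin = true ∧ k < alpha1 α then k + 1 else 0 := by
    have hB := blockIdx_pos_iff hn α (x := (k : ℤ) + 1) (by omega) (by omega)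
    have hB0 := blockIdx_nonneg α (x := (k : ℤ) + 1) (by omega)
    have hiff : ∀ i : ℤ, i < 0 → -((k : ℤ) + 1) ≤ i →
        (blockIdx α i = blockIdx α ((k : ℤ) + 1) ↔ α.isJoin = true ∧ k < alpha1 α) := by
      intro i hi0 hik
      have h1 := blockIdx_nonneg α (x := -i) (by omega)
      have h2 := blockIdx_mono hn α (x := -i) (y := (k : ℤ) + 1) (by omega) (by omega) (by omega)
      have h3 := blockIdx_neg α hi0.ne
      have h4 : blockIdx α i = blockIdx α ((k : ℤ) + 1) ↔ ¬ 0 < blockIdx α ((k : ℤ) + 1) := by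
        omega
      rw [h4, hB]
      push Not
      exact and_congr_right fun _ => by omega
    split_ifs with h
    · rw [show (U.filter fun i => blockIdx α i = blockIdx α ((k : ℤ) + 1)).filter
          (fun i => ¬ 0 < i) = Finset.Ico (-((k : ℤ) + 1)) 0 from ?_, Int.card_Ico]
      · omega
      · ext i
        simp only [hU, Finset.mem_filter, Finset.mem_erase, Finset.mem_Ico]
        constructor
        · rintro ⟨⟨⟨h1, h2, h3⟩, h4⟩, h5⟩
          omega
        · rintro ⟨h1, h2⟩
          exact ⟨⟨⟨by omega, by omega, by omega⟩, (hiff i h2 h1).2 h⟩, by omega⟩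
    · rw [Finset.card_eq_zero, Finset.filter_eq_empty_iff]
      intro i hi hi0
      simp only [hU, Finset.mem_filter, Finset.mem_erase, Finset.mem_Ico] at hi
      exact h ((hiff i (by omega) (by omega)).1 hi.2)
  rw [hA, ← hpos, ← hneg, ← hUcard]
  have e1 := Finset.card_filter_add_card_filter_not (s := U)
    (fun i => blockIdx α i = blockIdx α ((k : ℤ) + 1))
  have e2 := Finset.card_filter_add_card_filter_not
    (s := U.filter fun i => blockIdx α i = blockIdx α ((k : ℤ) + 1)) (fun i => 0 < i)
  omega

lemma alpha1_le {n : ℕ} (hn : 1 ≤ n) (α : BComp n) : alpha1 α ≤ n := by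
  obtain ⟨p, L, h⟩ := α.exists_parts hn
  have := α.sum_eq
  simp only [alpha1, h, List.headI_cons, List.sum_cons] at *
  omega

open Classical in
lemma card_isAdmissible {n : ℕ} (hn : 1 ≤ n) (α : BComp n) :
    ((pmFinset n ×ˢ pmFinset n).filter fun c => IsAdmissible α c.1 c.2).card =
      lengthFormula α := by
  have hfib : ((pmFinset n ×ˢ pmFinset n).filter fun c => IsAdmissible α c.1 c.2).card =
      ∑ k ∈ Finset.range n,
        ((pmFinset n).filter fun i => IsAdmissible α i ((k : ℤ) + 1)).card := by
    rw [← Finset.card_sigma]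
    refine Finset.card_nbij' (fun c => ⟨(c.2 - 1).toNat, c.1⟩) (fun s => (s.2, (s.1 : ℤ) + 1))
      ?_ ?_ ?_ ?_
    · intro c hc
      have h := (Finset.mem_filter.1 hc).2
      obtain ⟨h1, ⟨h2, h3, h4⟩, h5, h6, h7⟩ := id h
      simp only [Finset.coe_sigma, Set.mem_sigma_iff, Finset.mem_coe, Finset.mem_range,
        Finset.mem_filter, mem_pmFinset]
      refine ⟨by omega, h1, ?_⟩
      rwa [show (((c.2 - 1).toNat : ℤ)) + 1 = c.2 by omega]
    · intro s hs
      simp only [Finset.coe_sigma, Set.mem_sigma_iff, Finset.mem_coe, Finset.mem_range,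
        Finset.mem_filter, mem_pmFinset] at hs
      exact Finset.mem_filter.2 ⟨Finset.mem_product.2 ⟨mem_pmFinset.2 hs.2.1,
        mem_pmFinset.2 hs.2.2.2.1⟩, hs.2.2⟩
    · intro c hc
      obtain ⟨h1, h2, h5, h6, h7⟩ := (Finset.mem_filter.1 hc).2
      exact Prod.ext rfl (by dsimp only; omega)
    · intro s hs
      simp
  have hjoin : ∑ k ∈ Finset.range n, (if α.isJoin = true ∧ k < alpha1 α then k + 1 else 0) =
      if α.isJoin = true then (alpha1 α + 1) * alpha1 α / 2 else 0 := by
    by_cases hα : α.isJoin = true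
    · simp only [hα, true_and, if_true]
      rw [← Finset.sum_filter, show (Finset.range n).filter (· < alpha1 α) =
        Finset.range (alpha1 α) from ?_]
      · have := Finset.sum_range_id (alpha1 α + 1)
        rw [Finset.sum_range_succ'] at this
        simpa using this
      · have := alpha1_le hn α
        ext k
        simp only [Finset.mem_filter, Finset.mem_range]
        omega
    · simp [hα]
  have hbad := sum_card_listRegion_eq α.parts
  rw [α.sum_eq] at hbad
  have htotal : ∑ k ∈ Finset.range n, (2 * k + 1) = n ^ 2 := by
    clear hfib hjoin hbad hn α
    induction n with
    | zero => rfl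
    | succ n ih =>
      rw [Finset.sum_range_succ, ih]
      ring
  have hsum := Finset.sum_congr rfl fun k hk =>
    card_isAdmissible_right hn α (Finset.mem_range.1 hk)
  rw [Finset.sum_add_distrib, Finset.sum_add_distrib, hjoin, ← hfib, htotal] at hsum
  have hbad' : ∑ k ∈ Finset.range n, ((Finset.range k).filter fun i =>
      region α (i + 1) = region α (k + 1)).card =
      (α.parts.map fun a => a * (a - 1) / 2).sum := hbad
  rw [hbad'] at hsum
  unfold lengthFormula
  omega

/-- For every type-B composition `α = (α₁,…,α_r)` of `n`, the
number of join-irreducible elements of `Tam_B(α)` equals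
`n² − Σᵢ αᵢ(αᵢ−1)/2 − (α₁+1)α₁/2` if `α` is join, and
`n² − Σᵢ αᵢ(αᵢ−1)/2` if `α` is split. -/
theorem tamB_joinIrreducible_count (n : ℕ) (hn : 1 ≤ n) (α : BComp n) :
    {x : SignedPerm n | joinIrred α x}.ncard = lengthFormula α := by
  rw [ncard_joinIrred hn, card_isAdmissible hn]

end TypeB
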